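/- arXiv:1812.06231 — 5 statements merged into one kernel-verified Lean document; each statement's English description precedes it below -/
import Mathlib

section
/- Let q be an odd prime power and let m ≥ 2 be an integer with gcd(q-1, m(m-1)) = 2. Then for every d ∈ F_q, the number of monic polynomials of degree m in F_q[x] with discriminant equal to d is exactly q^(m-1). -/
open Polynomial
open scoped Classical

/-- The discriminant of a polynomial `f` of degree `m ≥ 2` over a field `F`, computed in an
algebraic closure via the standard formula
`disc(f) = (-1)^(m(m-1)/2) · a_m^(m-2) · ∏_i f'(α_i)`, where `a_m` is the leading coefficient
and the `α_i` are the roots of `f` (with multiplicity) in the algebraic closure; this equals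
`a_m^(2m-2) · ∏_{i<j} (α_i - α_j)^2`.  For `f` of degree at most 1 it is defined to be `1`. -/
noncomputable def polyDisc {F : Type*} [Field F] (f : F[X]) : AlgebraicClosure F :=
  if f.natDegree ≤ 1 then 1
  else
    (-1) ^ (f.natDegree * (f.natDegree - 1) / 2) *
      algebraMap F (AlgebraicClosure F) f.leadingCoeff ^ (f.natDegree - 2) *
      (Multiset.map (fun a => ((derivative f).map (algebraMap F (AlgebraicClosure F))).eval a)
        (f.map (algebraMap F (AlgebraicClosure F))).roots).prod

/-- The Möbius function on polynomials over a field: `μ f = (-1)^k` if `f` is squarefree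
with `k` (distinct) monic irreducible factors, and `μ f = 0` otherwise. -/
noncomputable def polyMu {F : Type*} [Field F] (f : F[X]) : ℤ :=
  if Squarefree f then (-1) ^ {π : F[X] | π.Monic ∧ Irreducible π ∧ π ∣ f}.ncard else 0

/-- `f` has factorization type `λ` (a partition of `m`): `f` is a product of distinct monic
irreducible polynomials whose degrees form the multiset of parts of `λ`.  The set
`S_{λ,F}` of monic squarefree polynomials of factorization type `λ` is
`{f | hasFactorizationType f λ}`. -/
def hasFactorizationType {F : Type*} [Field F] (f : F[X]) {m : ℕ} (lam : m.Partition) : Prop :=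
  ∃ s : Finset F[X], (∀ π ∈ s, π.Monic ∧ Irreducible π) ∧ (∏ π ∈ s, π) = f ∧
    Multiset.map natDegree s.val = lam.parts


namespace DiscCount

/-- resultant of `f` and its derivative -/
noncomputable def rd {F : Type*} [Field F] (f : F[X]) : F :=
  resultant f (derivative f) f.natDegree (f.natDegree - 1)

noncomputable def D {F : Type*} [Field F] (f : F[X]) : F :=
  (-1) ^ (f.natDegree * (f.natDegree - 1) / 2) * rd f

section
variable {F : Type*} [Field F]

/-- degree padding for monic `f` -/
lemma res_pad {f g : F[X]} (hf : f.Monic) {d : ℕ} (hd : g.natDegree ≤ d) :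
    resultant f g f.natDegree d = resultant f g := by
  obtain ⟨k, rfl⟩ := Nat.exists_eq_add_of_le hd
  rw [resultant_add_right_deg _ _ _ _ _ le_rfl]
  simp [hf]

lemma rd_eq {f : F[X]} (hf : f.Monic) : rd f = resultant f (derivative f) :=
  res_pad hf (natDegree_derivative_le f)

lemma res_eq_prod {f g : F[X]} (hf : f.Monic) :
    algebraMap F (AlgebraicClosure F) (resultant f g) =
      (Multiset.map (fun a => (g.map (algebraMap F (AlgebraicClosure F))).eval a)
        (f.map (algebraMap F (AlgebraicClosure F))).roots).prod := by
  rw [← resultant_map_map, ← natDegree_map (algebraMap F (AlgebraicClosure F)) (p := f),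
    resultant_eq_prod_eval _ _ _ (natDegree_map_le) (IsAlgClosed.splits _)]
  simp [hf.map]

lemma polyDisc_eq {f : F[X]} (hf : f.Monic) (h2 : 2 ≤ f.natDegree) :
    polyDisc f = algebraMap F (AlgebraicClosure F) (D f) := by
  rw [polyDisc, if_neg (by omega), D, rd_eq hf, map_mul, res_eq_prod hf]
  simp [hf]

lemma res_mul_right {f : F[X]} (hf : f.Monic) (g h : F[X]) :
    resultant f (g * h) = resultant f g * resultant f h := by
  rw [← resultant_mul_right _ _ _ _ le_rfl, res_pad hf natDegree_mul_le]

lemma res_mul_left {f g : F[X]} (hf : f.Monic) (hg : g.Monic) (h : F[X]) :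
    resultant (f * g) h = resultant f h * resultant g h := by
  rw [← resultant_mul_left _ _ _ _ le_rfl, hf.natDegree_mul hg]

lemma res_add_mul {f : F[X]} (hf : f.Monic) (g h : F[X]) :
    resultant f (g + f * h) = resultant f g := by
  apply (algebraMap F (AlgebraicClosure F)).injective
  rw [res_eq_prod hf, res_eq_prod hf]
  congr 1
  apply Multiset.map_congr rfl
  intro a ha
  have : (f.map (algebraMap F (AlgebraicClosure F))).eval a = 0 := by
    simpa using (mem_roots'.1 ha).2
  simp only [Polynomial.map_add, Polynomial.map_mul, eval_add, eval_mul, this]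
  simp

lemma D_mul {f g : F[X]} (hf : f.Monic) (hg : g.Monic) :
    D (f * g) = D f * D g * (resultant f g) ^ 2 := by
  have h1 : rd (f * g) = rd f * rd g * (-1) ^ (f.natDegree * g.natDegree) * (resultant f g) ^ 2 := by
    rw [rd_eq hf, rd_eq hg, rd_eq (hf.mul hg), derivative_mul, res_mul_left hf hg,
      res_add_mul hf, add_comm, mul_comm (derivative f) g, res_add_mul hg, res_mul_right hf,
      res_mul_right hg, resultant_comm g f]
    ring
  have h2 : (f * g).natDegree * ((f * g).natDegree - 1) / 2 =
      f.natDegree * (f.natDegree - 1) / 2 + g.natDegree * (g.natDegree - 1) / 2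
        + f.natDegree * g.natDegree := by
    rw [hf.natDegree_mul hg, ← Nat.choose_two_right, ← Nat.choose_two_right,
      ← Nat.choose_two_right]
    rw [Nat.add_choose_eq]
    simp [Finset.Nat.antidiagonal_succ]
    ring
  rw [D, D, D, h1, h2, pow_add, pow_add]
  have h3 : ((-1 : F) ^ (f.natDegree * g.natDegree)) * (-1) ^ (f.natDegree * g.natDegree) = 1 := by
    rw [← mul_pow]; simp
  linear_combination ((-1) ^ (f.natDegree * (f.natDegree - 1) / 2) * (-1) ^ (g.natDegree * (g.natDegree - 1) / 2) * rd f * rd g * (resultant f g) ^ 2) * h3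

lemma D_one : D (1 : F[X]) = 1 := by
  simp [D, rd]

lemma D_eq_zero_iff [Fintype F] {f : F[X]} (hf : f.Monic) : D f = 0 ↔ ¬ Squarefree f := by
  rw [← PerfectField.separable_iff_squarefree, D, rd_eq hf, Separable, mul_eq_zero,
    resultant_eq_zero_iff]
  simp [hf.ne_zero]

lemma derivative_scaleRoots' (f : F[X]) (c : F) :
    derivative (f.scaleRoots c) =
      C (c ^ (f.natDegree - 1 - (derivative f).natDegree)) * (derivative f).scaleRoots c := by
  ext i
  simp only [coeff_derivative, coeff_scaleRoots, coeff_C_mul]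
  by_cases h : i ≤ (derivative f).natDegree
  · have := natDegree_derivative_le f
    have h3 : f.natDegree - (i + 1) = (f.natDegree - 1 - (derivative f).natDegree) +
      ((derivative f).natDegree - i) := by omega
    rw [h3, pow_add]; ring
  · have := coeff_eq_zero_of_natDegree_lt (not_le.1 h)
    rw [coeff_derivative] at this
    rw [mul_right_comm, this]; simp

lemma D_scaleRoots {f : F[X]} (hf : f.Monic) (c : F) :
    D (f.scaleRoots c) = c ^ (f.natDegree * (f.natDegree - 1)) * D f := by
  have hs : (f.scaleRoots c).Monic := (monic_scaleRoots_iff c).2 hf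
  rw [D, D, natDegree_scaleRoots, rd_eq hs, rd_eq hf, derivative_scaleRoots', res_mul_right hs,
    resultant_scaleRoots, natDegree_scaleRoots]
  have : resultant (f.scaleRoots c) (C (c ^ (f.natDegree - 1 - (derivative f).natDegree))) =
    c ^ ((f.natDegree - 1 - (derivative f).natDegree) * f.natDegree) := by
    rw [resultant_C_right, natDegree_C, natDegree_scaleRoots, pow_mul]; simp
  rw [natDegree_scaleRoots] at this
  rw [this]
  have h3 : f.natDegree * (f.natDegree - 1) = (f.natDegree - 1 - (derivative f).natDegree) * f.natDegree + f.natDegree * (derivative f).natDegree := by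
    rw [mul_comm _ f.natDegree, ← mul_add, Nat.sub_add_cancel (natDegree_derivative_le f)]
  rw [h3]
  ring
end
end DiscCount

namespace DiscCount
section
variable {F : Type*} [Field F] [Fintype F]

lemma discr_alg_eq {L : Type*} [Field L] [Finite L] [Algebra F L] {n : ℕ}
    (hn : Module.finrank F L = n) (b : Fin n → L) :
    algebraMap F L (Algebra.discr F b) =
      (Matrix.of (fun i k : Fin n => b i ^ (Fintype.card F ^ (k : ℕ)))).det ^ 2 := by
  rw [Algebra.discr_def, RingHom.map_det, pow_two]
  conv_rhs => rw [← Matrix.det_transpose (Matrix.of _)]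
  conv_rhs =>
    arg 1
    rw [Matrix.det_transpose]
  rw [← Matrix.det_mul]
  congr 1
  ext i j
  rw [RingHom.mapMatrix_apply, Matrix.map_apply, Algebra.traceMatrix_apply, Algebra.traceForm_apply,
    FiniteField.algebraMap_trace_eq_sum_pow, Matrix.mul_apply, hn, ← Fin.sum_univ_eq_sum_range]
  simp [mul_pow, Nat.card_eq_fintype_card]

lemma frob_det {L : Type*} [Field L] [Finite L] [Algebra F L] {n : ℕ}
    (hn : Module.finrank F L = n) (b : Fin n → L) :
    (Matrix.of (fun i k : Fin n => b i ^ (Fintype.card F ^ (k : ℕ)))).det ^ (Fintype.card F) =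
      (-1) ^ (n - 1) *
      (Matrix.of (fun i k : Fin n => b i ^ (Fintype.card F ^ (k : ℕ)))).det := by
  have h0 : 0 < n := hn ▸ Module.finrank_pos
  obtain ⟨m, rfl⟩ := Nat.exists_eq_succ_of_ne_zero h0.ne'
  have h1 : (((Equiv.Perm.sign (finRotate (m+1)) : ℤˣ) : ℤ) : L) = (-1) ^ (m + 1 - 1) := by
    rw [sign_finRotate]; simp
  have hc : ∀ x : L, x ^ Fintype.card F ^ (m + 1) = x := by
    intro x
    have := Fintype.ofFinite L
    have h := FiniteField.pow_card x
    rw [Module.card_eq_pow_finrank (K := F), hn] at h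
    exact h
  rw [← h1, ← Matrix.det_permute']
  change FiniteField.frobeniusAlgHom F L _ = _
  rw [AlgHom.map_det]
  congr 1
  ext i k
  simp only [AlgHom.mapMatrix_apply, Matrix.map_apply, Matrix.of_apply, Matrix.submatrix_apply, id,
    finRotate_apply, FiniteField.coe_frobeniusAlgHom]
  rw [Fin.val_add_one]
  split_ifs with h
  · subst h
    rw [← pow_mul, ← pow_succ, Fin.val_last, hc]; simp
  · rw [← pow_mul, ← pow_succ]

lemma discr_alg_char (hF : ringChar F ≠ 2) {L : Type*} [Field L] [Finite L] [Algebra F L] {n : ℕ}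
    (hn : Module.finrank F L = n) (b : Fin n → L) (h0 : Algebra.discr F b ≠ 0) :
    quadraticChar F (Algebra.discr F b) = (-1) ^ (n - 1) := by
  have h1 : Algebra.discr F b ^ (Fintype.card F / 2) = (-1) ^ (n - 1) := by
    apply (algebraMap F L).injective
    have h2 := discr_alg_eq hn b
    have h3 := frob_det hn b
    set δ := (Matrix.of (fun i k : Fin n => b i ^ (Fintype.card F ^ (k : ℕ)))).det
    have hδ : δ ≠ 0 := by
      intro h
      rw [h] at h2
      apply h0
      apply (algebraMap F L).injective
      rw [h2]; simp
    have hodd := FiniteField.odd_card_of_char_ne_two hF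
    have h4 : Fintype.card F = 2 * (Fintype.card F / 2) + 1 := by omega
    rw [map_pow, h2, ← pow_mul]
    apply mul_right_cancel₀ hδ
    rw [← pow_succ, ← h4, h3]
    simp
  have h5 : ((quadraticChar F (Algebra.discr F b) : ℤ) : F) = (((-1) ^ (n - 1) : ℤ) : F) := by
    rw [quadraticChar_eq_pow_of_char_ne_two' hF, h1]; simp
  rcases quadraticChar_dichotomy h0 with h | h <;>
  rcases neg_one_pow_eq_or ℤ (n-1) with h' | h' <;> rw [h, h'] at h5 ⊢
  · exact absurd (by simpa using h5.symm) (Ring.neg_one_ne_one_of_char_ne_two hF)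
  · exact absurd (by simpa using h5) (Ring.neg_one_ne_one_of_char_ne_two hF)

lemma D_irreducible.{u} {F : Type u} [Field F] [Fintype F] {p : F[X]} (hp : p.Monic) (hi : Irreducible p) :
    ∃ (L : Type u) (_ : Field L) (_ : Finite L) (_ : Algebra F L) (b : Fin p.natDegree → L),
      Module.finrank F L = p.natDegree ∧ Algebra.discr F b = D p := by
  have := Fact.mk hi
  let pb := AdjoinRoot.powerBasis' hp
  have hfin : Module.Finite F (AdjoinRoot p) := pb.finite
  have hfin2 : Finite (AdjoinRoot p) := Module.finite_of_finite F
  have hdim : pb.dim = p.natDegree := AdjoinRoot.powerBasis'_dim hp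
  have hmin : minpoly F pb.gen = p := AdjoinRoot.minpoly_powerBasis_gen_of_monic hp
  have key : Algebra.discr F pb.basis = D p := by
    rw [Algebra.discr_powerBasis_eq_norm, D, rd_eq hp, pb.finrank, hdim, hmin]
    congr 1
    apply (algebraMap F (AlgebraicClosure F)).injective
    rw [Algebra.norm_eq_prod_embeddings, res_eq_prod hp]
    rw [@Fintype.prod_equiv (AdjoinRoot p →ₐ[F] AlgebraicClosure F) _ _ _ (_) _ pb.liftEquiv'
      (fun σ => σ (aeval pb.gen (derivative p))) (fun x => ((derivative p).map (algebraMap F (AlgebraicClosure F))).eval (x : AlgebraicClosure F)) ?_]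
    · rw [Finset.prod_mem_multiset (f := _) (g := fun x => ((derivative p).map (algebraMap F (AlgebraicClosure F))).eval x), Finset.prod_eq_multiset_prod, Multiset.toFinset_val,
        Multiset.dedup_eq_self.mpr, hmin]
      · rw [hmin]
        exact nodup_roots (.map (PerfectField.separable_of_irreducible hi))
      · intro x; rfl
    · intro σ
      rw [PowerBasis.liftEquiv'_apply_coe, eval_map_algebraMap, aeval_algHom_apply]
  have hfr : Module.finrank F (AdjoinRoot p) = p.natDegree := by rw [pb.finrank, hdim]
  refine ⟨AdjoinRoot p, inferInstance, hfin2, inferInstance, pb.basis ∘ (finCongr hdim).symm, hfr, ?_⟩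
  rw [Algebra.discr_reindex, key]

lemma char_irreducible (hF : ringChar F ≠ 2) {p : F[X]} (hp : p.Monic) (hi : Irreducible p) :
    quadraticChar F (D p) = (-1) ^ (p.natDegree - 1) := by
  obtain ⟨L, _, _, _, b, hn, hb⟩ := D_irreducible hp hi
  have h0 : D p ≠ 0 := by
    rw [Ne, D_eq_zero_iff hp, not_not]
    exact hi.squarefree
  rw [← hb] at h0 ⊢
  exact discr_alg_char hF hn b h0

end
end DiscCount

namespace DiscCount
section
variable {F : Type*} [Field F] [Fintype F]

lemma nat_card_monic (n : ℕ) :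
    Nat.card {f : F[X] // f.Monic ∧ f.natDegree = n} = Fintype.card F ^ n := by
  rw [Nat.card_congr ((monicEquivDegreeLT n).trans (degreeLTEquiv F n).toEquiv)]
  simp

lemma monic_finite (n : ℕ) : {f : F[X] | f.Monic ∧ f.natDegree = n}.Finite := by
  have : Finite ↑{f : F[X] | f.Monic ∧ f.natDegree = n} :=
    Finite.of_equiv _ ((monicEquivDegreeLT n).trans (degreeLTEquiv F n).toEquiv).symm
  exact Set.toFinite {f : F[X] | f.Monic ∧ f.natDegree = n}

variable (F) in
/-- monic polynomials of degree `n` -/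
noncomputable def M (n : ℕ) : Finset F[X] := (monic_finite n).toFinset

lemma mem_M {n : ℕ} {f : F[X]} : f ∈ M F n ↔ f.Monic ∧ f.natDegree = n := by simp [M]

lemma card_M (n : ℕ) : (M F n).card = Fintype.card F ^ n := by
  rw [← nat_card_monic (F := F) n, M, ← Set.ncard_eq_toFinset_card _ (monic_finite n)]
  rfl

/-- the (sign-twisted) discriminant character, playing the role of the Moebius function -/
noncomputable def mu (f : F[X]) : ℤ := (-1) ^ f.natDegree * quadraticChar F (D f)

lemma mu_mul {f g : F[X]} (hf : f.Monic) (hg : g.Monic) (hc : IsCoprime f g) :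
    mu (f * g) = mu f * mu g := by
  have h : resultant f g ≠ 0 := resultant_ne_zero _ _ hc
  rw [mu, mu, mu, D_mul hf hg, hf.natDegree_mul hg, pow_add, map_mul, map_mul,
    quadraticChar_sq_one' h]
  ring

lemma mu_one : mu (1 : F[X]) = 1 := by
  simp [mu, D_one]

lemma mu_irreducible (hF : ringChar F ≠ 2) {p : F[X]} (hp : p.Monic) (hi : Irreducible p) :
    mu p = -1 := by
  rw [mu, char_irreducible hF hp hi, ← pow_add]
  have := hi.natDegree_pos
  exact Odd.neg_one_pow (by rw [Nat.odd_iff]; omega)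

lemma mu_not_squarefree {f : F[X]} (hf : f.Monic) (h : ¬ Squarefree f) : mu f = 0 := by
  rw [mu, (D_eq_zero_iff hf).2 h]; simp

lemma exists_monic_factor (f : F[X]) :
    ∃ p : F[X], 0 < f.natDegree → p.Monic ∧ Irreducible p ∧ p ∣ f := by
  by_cases h : 0 < f.natDegree
  · obtain ⟨p, h1, h2, h3⟩ := exists_monic_irreducible_factor f (by
      intro hu
      have := natDegree_eq_zero_of_isUnit hu
      omega)
    exact ⟨p, fun _ => ⟨h1, h2, h3⟩⟩
  · exact ⟨0, fun h' => absurd h' h⟩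

noncomputable def pf (f : F[X]) : F[X] := (exists_monic_factor f).choose

lemma pf_spec {f : F[X]} (h : 0 < f.natDegree) : (pf f).Monic ∧ Irreducible (pf f) ∧ pf f ∣ f :=
  (exists_monic_factor f).choose_spec h

variable (F) in
noncomputable def P (n : ℕ) : Finset (F[X] × F[X]) :=
  (Finset.HasAntidiagonal.antidiagonal n).biUnion (fun ij => M F ij.1 ×ˢ M F ij.2)

lemma mem_P {n : ℕ} {x : F[X] × F[X]} :
    x ∈ P F n ↔ x.1.Monic ∧ x.2.Monic ∧ x.1.natDegree + x.2.natDegree = n := by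
  simp only [P, Finset.mem_biUnion, Finset.HasAntidiagonal.mem_antidiagonal, Finset.mem_product, mem_M, Prod.exists]
  constructor
  · rintro ⟨a, b, h, ⟨h1, rfl⟩, h2, rfl⟩; exact ⟨h1, h2, h⟩
  · rintro ⟨h1, h2, h⟩; exact ⟨_, _, h, ⟨h1, rfl⟩, h2, rfl⟩

lemma sum_P (n : ℕ) : ∑ x ∈ P F n, mu x.1 =
    ∑ ij ∈ Finset.HasAntidiagonal.antidiagonal n, (∑ f ∈ M F ij.1, mu f) * (Fintype.card F : ℤ) ^ ij.2 := by
  rw [P, Finset.sum_biUnion]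
  · apply Finset.sum_congr rfl
    intro ij _
    rw [Finset.sum_product, Finset.sum_mul]
    apply Finset.sum_congr rfl
    intro f _
    simp [card_M, mul_comm]
  · intro a _ b _ hab
    rw [Function.onFun, Finset.disjoint_left]
    intro x hx hy
    simp only [Finset.mem_product, mem_M] at hx hy
    apply hab
    ext
    · rw [← hx.1.2, ← hy.1.2]
    · rw [← hx.2.2, ← hy.2.2]

noncomputable def inv (x : F[X] × F[X]) : F[X] × F[X] :=
  if pf (x.1 * x.2) ∣ x.1 then (x.1 / pf (x.1 * x.2), x.2 * pf (x.1 * x.2))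
  else (x.1 * pf (x.1 * x.2), x.2 / pf (x.1 * x.2))

lemma inv_spec (hF : ringChar F ≠ 2) {n : ℕ} (hn : 0 < n) {x : F[X] × F[X]} (hx : x ∈ P F n)
    (hs : Squarefree x.1) :
    inv x ∈ P F n ∧ Squarefree (inv x).1 ∧ inv (inv x) = x ∧ mu x.1 + mu (inv x).1 = 0 := by
  obtain ⟨g, h⟩ := x
  obtain ⟨hg, hh, hd⟩ := mem_P.1 hx
  simp only at hg hh hd hs
  obtain ⟨hp, hi, hdvd⟩ := pf_spec (f := g * h) (by rw [hg.natDegree_mul hh]; omega)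
  by_cases hpg : pf (g * h) ∣ g
  · have h1 : inv (g, h) = (g / pf (g * h), h * pf (g * h)) := by simp [inv, hpg]
    rw [h1]
    generalize hpe : pf (g * h) = p at *
    obtain ⟨a, rfl⟩ := hpg
    rw [mul_div_cancel_left₀ _ hp.ne_zero]
    have ha : a.Monic := hp.of_mul_monic_left hg
    have hpa : ¬ p ∣ a := by
      rintro ⟨b, rfl⟩
      exact hi.not_isUnit (hs p ⟨b, by ring⟩)
    have hc : IsCoprime p a := (hi.coprime_iff_not_dvd).2 hpa
    have h2 : a * (h * p) = p * a * h := by ring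
    refine ⟨mem_P.2 ⟨ha, hh.mul hp, ?_⟩, hs.of_mul_right, ?_, ?_⟩
    · simp only
      rw [hh.natDegree_mul hp]
      rw [hp.natDegree_mul ha] at hd
      omega
    · simp only [inv, h2, hpe, hpa, if_false]
      rw [mul_div_cancel_right₀ _ hp.ne_zero, mul_comm]
    · simp only
      rw [mu_mul hp ha hc, mu_irreducible hF hp hi]; ring
  · have h1 : inv (g, h) = (g * pf (g * h), h / pf (g * h)) := by simp [inv, hpg]
    rw [h1]
    generalize hpe : pf (g * h) = p at *
    obtain ⟨b, rfl⟩ := (hi.prime.dvd_or_dvd hdvd).resolve_left hpg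
    rw [mul_div_cancel_left₀ _ hp.ne_zero]
    have hb : b.Monic := hp.of_mul_monic_left hh
    have hc : IsCoprime p g := (hi.coprime_iff_not_dvd).2 hpg
    have h2 : g * p * b = g * (p * b) := by ring
    refine ⟨mem_P.2 ⟨hg.mul hp, hb, ?_⟩, ?_, ?_, ?_⟩
    · simp only
      rw [hg.natDegree_mul hp]
      rw [hp.natDegree_mul hb] at hd
      omega
    · exact (squarefree_mul_iff).2 ⟨hc.symm.isRelPrime, hs, hi.squarefree⟩
    · simp only [inv, h2, hpe, dvd_mul_left, if_true]
      rw [mul_div_cancel_right₀ _ hp.ne_zero, mul_comm]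
    · simp only
      rw [mu_mul hg hp hc.symm, mu_irreducible hF hp hi]; ring

lemma sum_P_zero (hF : ringChar F ≠ 2) {n : ℕ} (hn : 0 < n) : ∑ x ∈ P F n, mu x.1 = 0 := by
  rw [← Finset.sum_filter_add_sum_filter_not (P F n) (fun x => Squarefree x.1),
    Finset.sum_eq_zero (s := {x ∈ P F n | ¬ Squarefree x.1}), add_zero]
  · have key : ∀ x ∈ {x ∈ P F n | Squarefree x.1}, inv x ∈ P F n ∧ Squarefree (inv x).1 ∧
        inv (inv x) = x ∧ mu x.1 + mu (inv x).1 = 0 := by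
      intro x hx
      rw [Finset.mem_filter] at hx
      exact inv_spec hF hn hx.1 hx.2
    refine Finset.sum_involution (fun x _ => inv x) ?_ ?_ ?_ ?_
    · intro x hx; exact (key x hx).2.2.2
    · intro x hx h0 h
      have := (key x hx).2.2.2
      rw [h] at this
      omega
    · intro x hx; exact Finset.mem_filter.2 ⟨(key x hx).1, (key x hx).2.1⟩
    · intro x hx; exact (key x hx).2.2.1
  · intro x hx
    rw [Finset.mem_filter, mem_P] at hx
    exact mu_not_squarefree hx.1.1 hx.2

lemma sum_mu (hF : ringChar F ≠ 2) {n : ℕ} (hn : 2 ≤ n) : ∑ f ∈ M F n, mu f = 0 := by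
  obtain ⟨k, rfl⟩ := Nat.exists_eq_add_of_le' hn
  have h1 := sum_P_zero hF (F := F) (n := k + 2) (by omega)
  have h2 := sum_P_zero hF (F := F) (n := k + 1) (by omega)
  rw [sum_P] at h1 h2
  rw [Finset.Nat.antidiagonal_succ', Finset.sum_cons, Finset.sum_map] at h1
  simp only [Function.Embedding.prodMap, Function.Embedding.coeFn_mk, Prod.map, pow_succ, ← mul_assoc, ← Finset.sum_mul,
    Function.Embedding.refl_apply, Nat.succ_eq_add_one] at h1
  rw [h2] at h1
  simpa using h1

/-- squarefree monics -/
lemma sq_decomp (n : ℕ) (f : F[X]) (hf : f.Monic) (hn : f.natDegree = n) :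
    ∃ g h : F[X], g.Monic ∧ h.Monic ∧ Squarefree h ∧ g ^ 2 * h = f := by
  induction n using Nat.strong_induction_on generalizing f with
  | _ n ih =>
    by_cases hs : Squarefree f
    · exact ⟨1, f, monic_one, hf, hs, by simp⟩
    · have hs' : ∃ p : F[X], p.Monic ∧ 0 < p.natDegree ∧ p * p ∣ f := by
        simp only [Squarefree, not_forall] at hs
        obtain ⟨p, hp, hu⟩ := hs
        have hp0 : p ≠ 0 := by
          rintro rfl
          simp at hp
          exact hf.ne_zero hp
        refine ⟨p * C p.leadingCoeff⁻¹, monic_mul_leadingCoeff_inv hp0, ?_, ?_⟩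
        · rw [natDegree_mul_leadingCoeff_inv _ hp0]
          by_contra h
          apply hu
          rw [isUnit_iff_degree_eq_zero, degree_eq_natDegree hp0]
          simp only [not_lt, Nat.le_zero] at h
          simp [h]
        · have hu2 : IsUnit (C p.leadingCoeff⁻¹ * C p.leadingCoeff⁻¹) := by
            rw [← C_mul]
            exact isUnit_C.2 (by simp [hp0])
          have : p * C p.leadingCoeff⁻¹ * (p * C p.leadingCoeff⁻¹) =
            p * p * (C p.leadingCoeff⁻¹ * C p.leadingCoeff⁻¹) := by ring
          rw [this]
          exact (hu2.mul_right_dvd).2 hp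
      obtain ⟨p, hp, hd, b, rfl⟩ := hs'
      have hb : b.Monic := (hp.mul hp).of_mul_monic_left hf
      rw [(hp.mul hp).natDegree_mul hb, hp.natDegree_mul hp] at hn
      obtain ⟨g, h, hg, hh, hsq, e⟩ := ih b.natDegree (by omega) b hb rfl
      exact ⟨p * g, h, hp.mul hg, hh, hsq, by rw [← e]; ring⟩

lemma sq_unique {g h g' h' : F[X]} (hg : g.Monic) (hg' : g'.Monic)
    (hs : Squarefree h) (hs' : Squarefree h') (e : g ^ 2 * h = g' ^ 2 * h') : g = g' ∧ h = h' := by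
  have aux : ∀ {g h g' h' : F[X]}, g.Monic → Squarefree h' → g ^ 2 * h = g' ^ 2 * h' → g ∣ g' := by
    intro g h g' h' hg hs' e
    obtain ⟨a, b, c, hr, rfl, rfl⟩ := UniqueFactorizationMonoid.exists_reduced_factors g hg.ne_zero g'
    have hc : c ≠ 0 := left_ne_zero_of_mul hg.ne_zero
    have h1 : a ^ 2 * h = b ^ 2 * h' := by
      apply mul_left_cancel₀ (pow_ne_zero 2 hc)
      linear_combination e
    have h2 : a ^ 2 ∣ h' := by
      have h3 : IsRelPrime (a ^ 2) (b ^ 2) := hr.pow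
      exact h3.dvd_of_dvd_mul_left ⟨h, h1.symm⟩
    have h4 : IsUnit a := hs' a (by rwa [← pow_two])
    exact mul_dvd_mul_left _ h4.dvd
  have h1 : g = g' := eq_of_monic_of_associated hg hg' (associated_of_dvd_dvd (aux hg hs' e) (aux hg' hs e.symm))
  subst h1
  exact ⟨rfl, mul_left_cancel₀ (pow_ne_zero 2 hg.ne_zero) e⟩

variable (F) in
/-- number of squarefree monic polynomials of degree `n` -/
noncomputable def Q (n : ℕ) : ℕ := ((M F n).filter Squarefree).card

lemma card_eq_sum_Q (n : ℕ) :
    Fintype.card F ^ n = ∑ k ∈ Finset.range (n / 2 + 1), Fintype.card F ^ k * Q F (n - 2 * k) := by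
  have h1 : (M F n) = ((Finset.range (n / 2 + 1)).biUnion (fun k =>
      M F k ×ˢ ((M F (n - 2 * k)).filter Squarefree))).image (fun x => x.1 ^ 2 * x.2) := by
    ext f
    simp only [Finset.mem_image, Finset.mem_biUnion, Finset.mem_range, Finset.mem_product,
      Finset.mem_filter, mem_M, Prod.exists]
    constructor
    · rintro ⟨hf, hn⟩
      obtain ⟨g, h, hg, hh, hs, rfl⟩ := sq_decomp n f hf hn
      rw [(hg.pow 2).natDegree_mul hh, hg.natDegree_pow] at hn
      exact ⟨g, h, ⟨g.natDegree, by omega, ⟨hg, rfl⟩, ⟨hh, by omega⟩, hs⟩, rfl⟩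
    · rintro ⟨g, h, ⟨k, hk, ⟨hg, rfl⟩, ⟨hh, hd⟩, hs⟩, rfl⟩
      refine ⟨(hg.pow 2).mul hh, ?_⟩
      rw [(hg.pow 2).natDegree_mul hh, hg.natDegree_pow]
      omega
  rw [← card_M, h1, Finset.card_image_of_injOn, Finset.card_biUnion]
  · apply Finset.sum_congr rfl
    intro k _
    rw [Finset.card_product, card_M, Q]
  · intro a _ b _ hab
    rw [Function.onFun, Finset.disjoint_left]
    intro x hx hy
    simp only [Finset.mem_product, mem_M] at hx hy
    apply hab
    rw [← hx.1.2, ← hy.1.2]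
  · rintro ⟨g, h⟩ hx ⟨g', h'⟩ hy e
    simp only [Finset.coe_biUnion, Set.mem_iUnion, Finset.mem_coe, Finset.mem_product, mem_M, Finset.mem_filter] at hx hy
    obtain ⟨k, _, ⟨hg, _⟩, _, hs⟩ := hx
    obtain ⟨k', _, ⟨hg', _⟩, _, hs'⟩ := hy
    obtain ⟨rfl, rfl⟩ := sq_unique hg hg' hs hs' e
    rfl

lemma Q_add (n : ℕ) : Q F (n + 2) + Fintype.card F ^ (n + 1) = Fintype.card F ^ (n + 2) := by
  rw [card_eq_sum_Q (n + 2), show (n + 2) / 2 + 1 = (n / 2 + 1) + 1 by omega, Finset.sum_range_succ',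
    pow_succ, card_eq_sum_Q n, Finset.sum_mul, add_comm]
  congr 1
  · apply Finset.sum_congr rfl
    intro k hk
    rw [show n + 2 - 2 * (k + 1) = n - 2 * k by omega]; ring
  · simp

variable (F) in
noncomputable def N (m : ℕ) (d : F) : ℕ := ((M F m).filter (fun f => D f = d)).card

lemma N_le_scale (m : ℕ) (d c : F) (hc : c ≠ 0) : N F m d ≤ N F m (c ^ (m * (m - 1)) * d) := by
  apply Finset.card_le_card_of_injOn (fun f => f.scaleRoots c)
  · intro f hf
    simp only [Finset.coe_filter, Set.mem_setOf_eq, mem_M] at hf ⊢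
    obtain ⟨⟨hf, rfl⟩, rfl⟩ := hf
    exact ⟨⟨(monic_scaleRoots_iff c).2 hf, natDegree_scaleRoots f c⟩, D_scaleRoots hf c⟩
  · intro f _ g _ h
    have h2 : (f.scaleRoots c).scaleRoots c⁻¹ = (g.scaleRoots c).scaleRoots c⁻¹ := by
      simp only at h; rw [h]
    rwa [← scaleRoots_mul, ← scaleRoots_mul, mul_inv_cancel₀ hc, scaleRoots_one,
      scaleRoots_one] at h2

lemma N_le_of_char {m : ℕ} (hgcd : Nat.gcd (Fintype.card F - 1) (m * (m - 1)) = 2)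
    {d d' : F} (hd : d ≠ 0) (hd' : d' ≠ 0) (h : quadraticChar F d = quadraticChar F d') :
    N F m d ≤ N F m d' := by
  have h1 : quadraticChar F (d' / d) = 1 := by
    have : quadraticChar F (d' / d) * quadraticChar F d = quadraticChar F d' := by
      rw [← map_mul, div_mul_cancel₀ _ hd]
    rw [h] at this
    exact mul_right_cancel₀ (by rw [Ne, quadraticChar_eq_zero_iff]; exact hd') (this.trans (one_mul _).symm)
  rw [quadraticChar_one_iff_isSquare (div_ne_zero hd' hd)] at h1
  obtain ⟨e, he⟩ := h1
  have he0 : e ≠ 0 := by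
    rintro rfl
    exact div_ne_zero hd' hd (by simpa using he)
  have hb := Nat.gcd_eq_gcd_ab (Fintype.card F - 1) (m * (m - 1))
  rw [hgcd] at hb
  set u := Nat.gcdA (Fintype.card F - 1) (m * (m - 1))
  set v := Nat.gcdB (Fintype.card F - 1) (m * (m - 1))
  have h3 : (e ^ v) ^ (m * (m - 1)) = e * e := by
    calc (e ^ v) ^ (m * (m - 1)) = e ^ (((m * (m - 1) : ℕ) : ℤ) * v) := by
          rw [← zpow_natCast, ← zpow_mul, mul_comm]
      _ = (e ^ (((Fintype.card F - 1 : ℕ) : ℤ) * u)) * e ^ (((m * (m - 1) : ℕ) : ℤ) * v) := by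
          rw [zpow_mul e _ u, zpow_natCast, FiniteField.pow_card_sub_one_eq_one e he0, one_zpow, one_mul]
      _ = e ^ (2 : ℤ) := by rw [← zpow_add₀ he0, ← hb]; rfl
      _ = e * e := by rw [zpow_two]
  have h4 := N_le_scale m d (e ^ v) (zpow_ne_zero _ he0)
  rwa [h3, ← he, div_mul_cancel₀ _ hd] at h4

lemma sum_N (m : ℕ) (φ : F → ℤ) : ∑ f ∈ M F m, φ (D f) = ∑ d : F, φ d * N F m d := by
  rw [← Finset.sum_fiberwise (M F m) (fun f => D f)]
  apply Finset.sum_congr rfl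
  intro d _
  rw [Finset.sum_congr rfl (g := fun _ => φ d)]
  · simp [N, mul_comm]
  · intro f hf
    rw [(Finset.mem_filter.1 hf).2]

lemma N_zero {m : ℕ} (hm : 2 ≤ m) : N F m 0 = Fintype.card F ^ (m - 1) := by
  obtain ⟨k, rfl⟩ := Nat.exists_eq_add_of_le' hm
  have h1 := Finset.card_filter_add_card_filter_not (s := M F (k + 2)) Squarefree
  rw [card_M] at h1
  have h2 : N F (k + 2) 0 = ((M F (k + 2)).filter (fun f => ¬ Squarefree f)).card := by
    rw [N]
    congr 1
    apply Finset.filter_congr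
    intro f hf
    exact D_eq_zero_iff (mem_M.1 hf).1
  have h3 := Q_add (F := F) k
  rw [Q] at h3
  rw [h2, show k + 2 - 1 = k + 1 by omega]
  omega

lemma N_eq (hF : ringChar F ≠ 2) {m : ℕ} (hm : 2 ≤ m)
    (hgcd : Nat.gcd (Fintype.card F - 1) (m * (m - 1)) = 2) (d : F) :
    N F m d = Fintype.card F ^ (m - 1) := by
  obtain ⟨ν, hν⟩ := quadraticChar_exists_neg_one hF
  have hν0 : ν ≠ 0 := by rintro rfl; simp at hν
  have h1 : quadraticChar F (1 : F) = 1 := map_one _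
  have hA : ∀ d : F, quadraticChar F d = 1 → N F m d = N F m 1 := by
    intro d hd
    have hd0 : d ≠ 0 := by rintro rfl; simp at hd
    exact le_antisymm (N_le_of_char hgcd hd0 one_ne_zero (hd.trans h1.symm))
      (N_le_of_char hgcd one_ne_zero hd0 (h1.trans hd.symm))
  have hB : ∀ d : F, quadraticChar F d = -1 → N F m d = N F m ν := by
    intro d hd
    have hd0 : d ≠ 0 := by rintro rfl; simp at hd
    exact le_antisymm (N_le_of_char hgcd hd0 hν0 (hd.trans hν.symm))
      (N_le_of_char hgcd hν0 hd0 (hν.trans hd.symm))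
  -- the character sum vanishes
  have hS : ∑ d : F, quadraticChar F d * (N F m d : ℤ) = 0 := by
    rw [← sum_N m (fun d => quadraticChar F d)]
    have h2 := sum_mu hF (F := F) hm
    have h3 : ∑ f ∈ M F m, mu f = (-1) ^ m * ∑ f ∈ M F m, quadraticChar F (D f) := by
      rw [Finset.mul_sum]
      apply Finset.sum_congr rfl
      intro f hf
      rw [mu, (mem_M.1 hf).2]
    rw [h3] at h2
    exact (mul_eq_zero.1 h2).resolve_left (pow_ne_zero _ (by norm_num))
  have hq1 : 1 < Fintype.card F := Fintype.one_lt_card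
  have hcard : ∑ d : F, quadraticChar F d ^ 2 = (Fintype.card F : ℤ) - 1 := by
    rw [← Finset.sum_erase_add _ _ (Finset.mem_univ (0 : F)),
      Finset.sum_congr rfl (g := fun _ => (1 : ℤ))
        (fun d hd => quadraticChar_sq_one (Finset.ne_of_mem_erase hd))]
    simp only [Finset.sum_const, Finset.card_erase_of_mem (Finset.mem_univ (0 : F)), Finset.card_univ]
    simp [Nat.cast_sub hq1.le]
  have key : ∀ d : F, 2 * (quadraticChar F d * (N F m d : ℤ)) =
      quadraticChar F d * ((N F m 1 : ℤ) + N F m ν) +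
        quadraticChar F d ^ 2 * ((N F m 1 : ℤ) - N F m ν) := by
    intro d
    by_cases hd : d = 0
    · subst hd; simp
    rcases quadraticChar_dichotomy hd with h | h
    · rw [hA d h, h]; ring
    · rw [hB d h, h]; ring
  have hAB : (N F m 1 : ℤ) = N F m ν := by
    have h5 : ∑ d : F, 2 * (quadraticChar F d * (N F m d : ℤ)) = 0 := by
      rw [← Finset.mul_sum, hS, mul_zero]
    rw [Finset.sum_congr rfl (fun d _ => key d), Finset.sum_add_distrib, ← Finset.sum_mul,
      ← Finset.sum_mul, quadraticChar_sum_zero hF, hcard, zero_mul, zero_add] at h5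
    have h6 : ((Fintype.card F : ℤ) - 1) ≠ 0 := by omega
    have := (mul_eq_zero.1 h5).resolve_left h6
    omega
  have hall : ∀ d : F, d ≠ 0 → N F m d = N F m 1 := by
    intro d hd
    rcases quadraticChar_dichotomy hd with h | h
    · exact hA d h
    · rw [hB d h]; exact_mod_cast hAB.symm
  have h0 := N_zero (F := F) hm
  have htot := sum_N (F := F) m (fun _ => 1)
  have hsum : ∑ x ∈ Finset.univ.erase (0 : F), (1 : ℤ) * (N F m x : ℤ)
      = ∑ x ∈ Finset.univ.erase (0 : F), (N F m 1 : ℤ) :=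
    Finset.sum_congr rfl (fun d hd => by rw [hall d (Finset.ne_of_mem_erase hd), one_mul])
  rw [← Finset.sum_erase_add _ _ (Finset.mem_univ (0 : F)), hsum, h0] at htot
  simp only [Finset.sum_const, Finset.card_erase_of_mem (Finset.mem_univ (0 : F)), Finset.card_univ,
    card_M] at htot
  by_cases hd : d = 0
  · rw [hd, h0]
  rw [hall d hd]
  obtain ⟨k, rfl⟩ := Nat.exists_eq_add_of_le' hm
  rw [show k + 2 - 1 = k + 1 by omega] at htot ⊢
  have h6 : ((Fintype.card F : ℤ) - 1) ≠ 0 := by omega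
  simp only [nsmul_eq_mul, Nat.cast_sub hq1.le, mul_one, one_mul, Nat.cast_pow, Nat.cast_one] at htot
  have : ((N F (k + 2) 1 : ℕ) : ℤ) = (Fintype.card F : ℤ) ^ (k + 1) := by
    apply mul_left_cancel₀ h6
    linear_combination -htot
  exact_mod_cast this

end
end DiscCount

/-- If `q` is an odd prime power and `m ≥ 2` satisfies `gcd(q-1, m(m-1)) = 2`, then every
`d ∈ F_q` is the discriminant of exactly `q^(m-1)` monic polynomials of degree `m`. -/
theorem stmt0 {F : Type*} [Field F] [Fintype F] (q m : ℕ) (hq : Fintype.card F = q)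
    (hodd : Odd q) (hm : 2 ≤ m) (hgcd : Nat.gcd (q - 1) (m * (m - 1)) = 2) (d : F) :
    {f : F[X] | f.Monic ∧ f.natDegree = m ∧
        polyDisc f = algebraMap F (AlgebraicClosure F) d}.ncard = q ^ (m - 1) := by
  subst hq
  have hF : ringChar F ≠ 2 := by
    intro h
    have := FiniteField.even_card_iff_char_two.1 h
    rw [Nat.odd_iff] at hodd
    omega
  rw [← DiscCount.N_eq hF hm hgcd d, DiscCount.N, ← Set.ncard_coe_finset]
  congr 1
  ext f
  simp only [Set.mem_setOf_eq, Finset.coe_filter, DiscCount.mem_M, and_assoc]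
  refine and_congr_right fun h1 => and_congr_right fun h2 => ?_
  rw [DiscCount.polyDisc_eq h1 (h2 ▸ hm)]
  exact (algebraMap F (AlgebraicClosure F)).injective.eq_iff
end

section
/- (Stickelberger–Swan) Let q be an odd prime power and let f ∈ F_q[x] be a squarefree monic polynomial of degree m ≥ 2 with k distinct monic irreducible factors. Then m and k have the same parity if and only if disc(f) is a square in F_q^×. Equivalently, for all monic nonconstant f ∈ F_q[x] of degree m ≥ 2 (squarefree or not), χ_q(disc(f)) = (-1)^(deg f) · μ(f), where χ_q is extended by χ_q(0) = 0. -/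
open Polynomial
open scoped Classical

lemma ss_res_deg {F : Type*} [Field F] (f g : F[X]) (hf : f.Monic) (n : ℕ) (hn : g.natDegree ≤ n) :
    resultant f g f.natDegree n = resultant f g := by
  obtain ⟨k, rfl⟩ := Nat.exists_eq_add_of_le hn
  rw [resultant_add_right_deg _ _ _ _ _ le_rfl]
  simp [hf.coeff_natDegree]

lemma ss_res_mul {F : Type*} [Field F] (f g h : F[X]) (hf : f.Monic) :
    resultant f (g * h) = resultant f g * resultant f h := by
  rw [← resultant_mul_right _ _ _ _ le_rfl, ss_res_deg _ _ hf _ natDegree_mul_le]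

lemma ss_res_add {F : Type*} [Field F] (f g h : F[X]) (hf : f.Monic) :
    resultant f (g + f * h) = resultant f g := by
  set n := max (g.natDegree) (h.natDegree + f.natDegree) with hn
  have h1 : (g + f * h).natDegree ≤ n := by
    refine (natDegree_add_le _ _).trans (max_le_max le_rfl ?_)
    rw [add_comm]; exact natDegree_mul_le
  rw [← ss_res_deg f _ hf n h1, ← ss_res_deg f _ hf n (le_max_left _ _),
    resultant_add_mul_right _ _ _ _ _ (le_max_right _ _) le_rfl]

noncomputable def ssDisc {F : Type*} [Field F] (f : F[X]) : F :=
  (-1) ^ (f.natDegree * (f.natDegree - 1) / 2) * resultant f (derivative f)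

lemma ss_choose_add (m n : ℕ) : (m + n) * (m + n - 1) / 2 =
    m * (m - 1) / 2 + n * (n - 1) / 2 + m * n := by
  simp only [← Nat.choose_two_right]
  induction n with
  | zero => simp
  | succ n ih => rw [← add_assoc, Nat.choose_succ_succ' (m + n) 1, Nat.choose_succ_succ' n 1, ih]; simp; ring

lemma ssDisc_mul {F : Type*} [Field F] (f g : F[X]) (hf : f.Monic) (hg : g.Monic) :
    ssDisc (f * g) = ssDisc f * ssDisc g * resultant f g ^ 2 := by
  have h1 : resultant (f * g) (derivative (f * g)) =
      resultant f (derivative (f * g)) * resultant g (derivative (f * g)) := by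
    rw [← resultant_mul_left _ _ _ _ le_rfl, hf.natDegree_mul hg]
  have h2 : resultant f (derivative (f * g)) = resultant f (derivative f) * resultant f g := by
    rw [derivative_mul, ss_res_add _ _ _ hf, ss_res_mul _ _ _ hf]
  have h3 : resultant g (derivative (f * g)) = resultant g (derivative g) * resultant g f := by
    rw [derivative_mul, add_comm, mul_comm _ g, ss_res_add _ _ _ hg, ss_res_mul _ _ _ hg]
    ring
  have h4 := resultant_comm g f g.natDegree f.natDegree
  unfold ssDisc
  rw [h1, h2, h3, h4, hf.natDegree_mul hg, ss_choose_add, mul_comm g.natDegree f.natDegree]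
  have : ((-1 : F) ^ (f.natDegree * g.natDegree)) ^ 2 = 1 := by
    rw [← pow_mul, mul_comm, pow_mul]; simp
  simp only [pow_add]
  generalize (-1 : F) ^ (g.natDegree * (g.natDegree - 1) / 2) = y at *
  generalize (-1 : F) ^ (f.natDegree * (f.natDegree - 1) / 2) = x at *
  generalize (-1 : F) ^ (f.natDegree * g.natDegree) = z at *
  linear_combination (resultant f g ^ 2 * resultant f (derivative f) * resultant g (derivative g) *
    x * y) * this

lemma ssDisc_map {F L : Type*} [Field F] [Field L] (φ : F →+* L) (f : F[X]) (hf : f.Monic)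
    (hs : (f.map φ).Splits) :
    φ (ssDisc f) = (-1) ^ (f.natDegree * (f.natDegree - 1) / 2) *
      ((f.map φ).roots.map (fun a => ((derivative f).map φ).eval a)).prod := by
  have h := resultant_eq_prod_eval (f.map φ) ((derivative f).map φ) _ (natDegree_map_le) hs
  rw [natDegree_map, resultant_map_map, (hf.map φ).leadingCoeff] at h
  simp [ssDisc, h]

lemma ss_polyDisc {F : Type*} [Field F] (f : F[X]) (hf : f.Monic) (h2 : 2 ≤ f.natDegree) :
    polyDisc f = algebraMap F (AlgebraicClosure F) (ssDisc f) := by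
  rw [ssDisc_map _ _ hf (IsAlgClosed.splits _), polyDisc, if_neg (by omega)]
  simp [hf.leadingCoeff]

lemma ss_vander {L : Type*} [Field L] (n : ℕ) (v : Fin n → L) :
    (-1) ^ (n * (n - 1) / 2) * ∏ i, (derivative (∏ j, (X - C (v j)))).eval (v i) =
      (Matrix.vandermonde v).det ^ 2 := by
  have h : ∀ i, (derivative (∏ j, (X - C (v j)))).eval (v i) = ∏ j ∈ {i}ᶜ, (v i - v j) := by
    intro i
    rw [derivative_prod_finset, eval_finsetSum, Finset.sum_eq_single i]
    · simp [eval_prod, Finset.compl_singleton]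
    · intro j _ hj
      simp only [eval_mul, eval_prod]
      rw [Finset.prod_eq_zero (i := i)]
      · simp
      · simp [hj.symm]
      · simp
    · simp
  simp_rw [h]
  rw [← Finset.prod_prod_Ioi_mul_eq_prod_prod_off_diag (fun j i => v i - v j),
    Matrix.det_vandermonde]
  have h3 : ∀ i j : Fin n, (v i - v j) * (v j - v i) = (-1) * (v j - v i) ^ 2 := by
    intros; ring
  simp_rw [h3, Finset.prod_mul_distrib, Finset.prod_pow, Finset.prod_const, Fin.card_Ioi]
  rw [Finset.prod_pow_eq_pow_sum, ← mul_assoc, ← pow_add]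
  have : ∑ i : Fin n, (n - 1 - (i : ℕ)) = n * (n - 1) / 2 := by
    rw [Finset.sum_range (fun i => n - 1 - i) |>.symm, Finset.sum_range_reflect (fun i => i),
      Finset.sum_range_id]
  rw [this, Even.neg_one_pow ⟨_, rfl⟩, one_mul]

lemma ss_irred {F : Type*} [Field F] [Fintype F] [DecidableEq F]
    (hodd : Odd (Fintype.card F)) (f : F[X]) (hf : f.Monic) (hi : Irreducible f) :
    ssDisc f ≠ 0 ∧ quadraticChar F (ssDisc f) = (-1 : ℤ) ^ (f.natDegree + 1) := by
  have : Fact (Irreducible f) := ⟨hi⟩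
  let L := AdjoinRoot f
  let pb := AdjoinRoot.powerBasis hi.ne_zero
  have : Module.Finite F L := pb.finite
  have : Finite L := Module.finite_of_finite F
  set q := Fintype.card F with hq
  set n := f.natDegree with hn
  have hn0 : 0 < n := hi.natDegree_pos
  have hfr : Module.finrank F L = n := by rw [pb.finrank]; exact AdjoinRoot.powerBasis_dim _
  let α : L := AdjoinRoot.root f
  let φ := FiniteField.frobeniusAlgHom F L
  have hφ : ∀ x, φ x = x ^ q := fun x => rfl
  let v : Fin n → L := fun i => (φ ^ (i : ℕ)) α
  have hpowext : ∀ a b : ℕ, (φ ^ a) α = (φ ^ b) α → φ ^ a = φ ^ b := by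
    intro a b h
    apply AdjoinRoot.algHom_ext
    exact h
  have hord : orderOf φ = n := by rw [← hfr]; exact FiniteField.orderOf_frobeniusAlgHom F L
  have hinj : Function.Injective v := by
    intro a b h
    have h1 := hpowext _ _ h
    have := pow_injOn_Iio_orderOf (x := φ) (by simp [hord]) (by simp [hord]) h1
    exact Fin.ext this
  have hroot : ∀ i, (f.map (algebraMap F L)).IsRoot (v i) := by
    intro i
    rw [IsRoot.def, eval_map_algebraMap]
    change aeval ((φ ^ (i : ℕ)) α) f = 0
    rw [aeval_algHom_apply]
    have h0 : aeval α f = 0 := by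
      change aeval (AdjoinRoot.root f) f = 0
      rw [AdjoinRoot.aeval_eq, AdjoinRoot.mk_self]
    rw [h0, map_zero]
  have hprod : f.map (algebraMap F L) = ∏ i, (X - C (v i)) := by
    apply eq_of_monic_of_dvd_of_natDegree_le (monic_prod_X_sub_C _ _) (hf.map _)
    · apply Finset.prod_dvd_of_coprime
      · intro a _ b _ hab
        exact pairwise_coprime_X_sub_C hinj hab
      · intro i _
        exact dvd_iff_isRoot.mpr (hroot i)
    · simp [hn]
  have hd : algebraMap F L (ssDisc f) = (Matrix.vandermonde v).det ^ 2 := by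
    rw [ssDisc_map _ _ hf, ← ss_vander, ← derivative_map, hprod]
    · congr 1
      have : (∏ i, (X - C (v i))).roots = Finset.univ.val.map v := by
        have := roots_multiset_prod_X_sub_C (Finset.univ.val.map v)
        rw [Multiset.map_map] at this
        exact this
      rw [this, Multiset.map_map]
      rfl
    · rw [hprod]
      exact Splits.prod fun i _ => Splits.X_sub_C _
  set D := (Matrix.vandermonde v).det with hD
  have hD0 : D ≠ 0 := Matrix.det_vandermonde_ne_zero_iff.mpr hinj
  have hDq : D ^ q = (-1) ^ (n - 1) * D := by
    rw [← hφ, hD]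
    have h1 : φ (Matrix.vandermonde v).det = ((Matrix.vandermonde v).submatrix (finRotate n) id).det := by
      rw [AlgHom.map_det]
      congr 1
      ext i j
      simp only [AlgHom.mapMatrix_apply, Matrix.map_apply, Matrix.vandermonde_apply, map_pow,
        Matrix.submatrix_apply, id]
      congr 1
      have h2 : φ (v i) = (φ ^ ((i : ℕ) + 1)) α := by rw [pow_succ']; rfl
      rw [h2]
      show _ = (φ ^ ((finRotate n i : Fin n) : ℕ)) α
      obtain ⟨m, hm⟩ : ∃ m, n = m + 1 := ⟨n - 1, by omega⟩
      have h3 : ((finRotate n i : Fin n) : ℕ) = ((i : ℕ) + 1) % n := by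
        clear_value n
        subst hm
        rw [finRotate_apply, Fin.val_add_one]
        split_ifs with h
        · simp [h]
        · rw [Nat.mod_eq_of_lt]
          have := i.2
          have : (i : ℕ) ≠ m := fun h' => h (Fin.ext h')
          omega
      have h4 := pow_mod_orderOf φ ((i : ℕ) + 1)
      rw [hord] at h4
      rw [h3, h4]
    rw [h1, Matrix.det_permute, sign_finRotate]
    simp
  have hd0 : ssDisc f ≠ 0 := by
    intro h
    rw [h, map_zero] at hd
    exact hD0 (pow_eq_zero_iff (two_ne_zero) |>.mp hd.symm)
  refine ⟨hd0, ?_⟩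
  have hch : ringChar F ≠ 2 := by
    intro h
    have := FiniteField.even_card_of_char_two h
    rw [Nat.odd_iff] at hodd
    omega
  have hpow : (ssDisc f) ^ (q / 2) = (-1) ^ (n - 1) := by
    apply (algebraMap F L).injective
    rw [map_pow, hd, ← pow_mul]
    have : 2 * (q / 2) = q - 1 := by rw [Nat.odd_iff] at hodd; omega
    rw [this]
    apply mul_right_cancel₀ hD0
    rw [← pow_succ, Nat.sub_add_cancel Fintype.card_pos, hDq]
    simp
  rw [quadraticChar_eq_pow_of_char_ne_two hch hd0, hpow]
  have hne : (-1 : F) ≠ 1 := Ring.neg_one_ne_one_of_char_ne_two hch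
  have hnn : n + 1 = (n - 1) + 2 := by omega
  rw [hnn, pow_add]
  rcases Nat.even_or_odd (n - 1) with h | h
  · simp [h.neg_one_pow]
  · simp [h.neg_one_pow, hne]

lemma ss_sqfree {F : Type*} [Field F] [Fintype F] [DecidableEq F]
    (hodd : Odd (Fintype.card F)) (N : ℕ) : ∀ f : F[X], f.natDegree = N → f.Monic → Squarefree f →
    ssDisc f ≠ 0 ∧ {π : F[X] | π.Monic ∧ Irreducible π ∧ π ∣ f}.Finite ∧
    quadraticChar F (ssDisc f) =
      (-1 : ℤ) ^ (f.natDegree + {π : F[X] | π.Monic ∧ Irreducible π ∧ π ∣ f}.ncard) := by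
  induction N using Nat.strong_induction_on with
  | _ N ih =>
  intro f hN hf hs
  by_cases hu : IsUnit f
  · obtain rfl := hf.eq_one_of_isUnit hu
    have : {π : F[X] | π.Monic ∧ Irreducible π ∧ π ∣ 1} = ∅ := by
      ext π
      simp only [Set.mem_ofPred_eq, Set.mem_empty_iff_false, iff_false]
      rintro ⟨_, h, h'⟩
      exact h.not_isUnit (isUnit_of_dvd_one h')
    rw [this]
    simp [ssDisc]
  · obtain ⟨p, hpm, hpi, g, rfl⟩ := exists_monic_irreducible_factor f hu
    have hg : g.Monic := hpm.of_mul_monic_left hf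
    have hdeg := hpm.natDegree_mul hg
    have hpp := hpi.natDegree_pos
    obtain ⟨h0, hfin, hq⟩ := ih g.natDegree (by omega) g rfl hg (hs.squarefree_of_dvd (dvd_mul_left _ _))
    have hpg : ¬ p ∣ g := by
      intro h
      exact hpi.not_isUnit (hs p (mul_dvd_mul_left p h))
    have hco : IsCoprime p g := (hpi.coprime_iff_not_dvd).mpr hpg
    obtain ⟨hp0, hpq⟩ := ss_irred hodd p hpm hpi
    have hr := resultant_ne_zero p g hco
    have hset : {π : F[X] | π.Monic ∧ Irreducible π ∧ π ∣ p * g} =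
        insert p {π : F[X] | π.Monic ∧ Irreducible π ∧ π ∣ g} := by
      ext π
      simp only [Set.mem_ofPred_eq, Set.mem_insert_iff]
      constructor
      · rintro ⟨h1, h2, h3⟩
        rcases h2.prime.dvd_or_dvd h3 with h | h
        · left
          exact eq_of_monic_of_associated h1 hpm (h2.associated_of_dvd hpi h)
        · exact Or.inr ⟨h1, h2, h⟩
      · rintro (rfl | ⟨h1, h2, h3⟩)
        · exact ⟨hpm, hpi, dvd_mul_right _ _⟩
        · exact ⟨h1, h2, h3.mul_left _⟩
    rw [hset, ssDisc_mul _ _ hpm hg, Set.ncard_insert_of_notMem (fun h => hpg h.2.2) hfin]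
    refine ⟨mul_ne_zero (mul_ne_zero hp0 h0) (pow_ne_zero 2 hr), hfin.insert _, ?_⟩
    rw [map_mul, map_mul, quadraticChar_sq_one' hr, hpq, hq, hdeg]
    ring

lemma ss_not_sqfree {F : Type*} [Field F] (f : F[X]) (hf : f.Monic) (hs : ¬ Squarefree f) :
    ssDisc f = 0 := by
  unfold ssDisc
  rw [mul_eq_zero]; right
  by_contra h
  apply hs
  have : IsCoprime f (derivative f) := by
    by_contra hc
    exact h (resultant_eq_zero_iff.mpr ⟨Or.inl hf.ne_zero, hc⟩)
  exact Separable.squarefree this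

theorem stmt4 {F : Type*} [Field F] [Fintype F] [DecidableEq F]
    (hodd : Odd (Fintype.card F)) :
    (∀ f : F[X], f.Monic → Squarefree f → 2 ≤ f.natDegree → ∀ k : ℕ,
      {π : F[X] | π.Monic ∧ Irreducible π ∧ π ∣ f}.ncard = k →
      (f.natDegree % 2 = k % 2 ↔
        ∃ d : F, d ≠ 0 ∧ IsSquare d ∧ polyDisc f = algebraMap F (AlgebraicClosure F) d)) ∧
    (∀ f : F[X], f.Monic → 2 ≤ f.natDegree →
      ∃ d : F, polyDisc f = algebraMap F (AlgebraicClosure F) d ∧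
        quadraticChar F d = (-1 : ℤ) ^ f.natDegree * polyMu f) := by
  constructor
  · rintro f hf hs h2 k rfl
    obtain ⟨h0, -, hq⟩ := ss_sqfree hodd _ f rfl hf hs
    rw [ss_polyDisc f hf h2]
    have e1 : (∃ d : F, d ≠ 0 ∧ IsSquare d ∧ algebraMap F (AlgebraicClosure F) (ssDisc f) =
        algebraMap F (AlgebraicClosure F) d) ↔ quadraticChar F (ssDisc f) = 1 := by
      rw [quadraticChar_one_iff_isSquare h0]
      constructor
      · rintro ⟨d, -, h, h'⟩
        rwa [(algebraMap F (AlgebraicClosure F)).injective h']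
      · intro h
        exact ⟨_, h0, h, rfl⟩
    rw [e1, hq, neg_one_pow_eq_one_iff_even (by norm_num), Nat.even_iff]
    omega
  · intro f hf h2
    refine ⟨ssDisc f, ss_polyDisc f hf h2, ?_⟩
    unfold polyMu
    split_ifs with hs
    · obtain ⟨h0, -, hq⟩ := ss_sqfree hodd _ f rfl hf hs
      rw [hq, pow_add]
    · rw [ss_not_sqfree f hf hs]
      simp
end

section
/- For any odd prime power q and any integer m ≥ 2, the number of monic polynomials of degree m in F_q[x] whose discriminant is a nonzero square in F_q equals the number of monic polynomials of degree m in F_q[x] whose discriminant is a nonsquare in F_q. -/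
open Polynomial
open scoped Classical

open Module

noncomputable def rootProd {F : Type*} [Field F] (f g : F[X]) : AlgebraicClosure F :=
  (Multiset.map (fun a => (g.map (algebraMap F (AlgebraicClosure F))).eval a)
        (f.map (algebraMap F (AlgebraicClosure F))).roots).prod

noncomputable def dd {F : Type*} [Field F] (f : F[X]) : F :=
  (-1) ^ (f.natDegree * (f.natDegree - 1) / 2) *
    resultant f (derivative f) f.natDegree (f.natDegree - 1)

section
variable {F : Type*} [Field F]

lemma res_eq (f g : F[X]) (hf : f.Monic) (n : ℕ) (hg : g.natDegree ≤ n) :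
    algebraMap F (AlgebraicClosure F) (resultant f g f.natDegree n) = rootProd f g := by
  rw [← resultant_map_map]
  have := resultant_eq_prod_eval (f.map (algebraMap F (AlgebraicClosure F)))
    (g.map (algebraMap F (AlgebraicClosure F))) n (by simpa using hg) (IsAlgClosed.splits _)
  rw [natDegree_map] at this
  rw [this, (hf.map _).leadingCoeff]
  simp [rootProd]

lemma dd_eq (f : F[X]) (hf : f.Monic) :
    algebraMap F (AlgebraicClosure F) (dd f) =
      (-1) ^ (f.natDegree * (f.natDegree - 1) / 2) * rootProd f (derivative f) := by
  rw [dd, map_mul, res_eq f _ hf _ (natDegree_derivative_le f)]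
  simp

lemma polyDisc_eq (f : F[X]) (hf : f.Monic) (h : 2 ≤ f.natDegree) :
    polyDisc f = algebraMap F (AlgebraicClosure F) (dd f) := by
  rw [dd_eq f hf, polyDisc, if_neg (by omega), hf.leadingCoeff]
  simp [rootProd]

lemma rootProd_mul_left (f g h : F[X]) (hf : f.Monic) (hg : g.Monic) :
    rootProd (f * g) h = rootProd f h * rootProd g h := by
  rw [rootProd, Polynomial.map_mul, roots_mul ((hf.map _).mul (hg.map _)).ne_zero]
  simp [rootProd]

lemma rootProd_mul_right (f g h : F[X]) :
    rootProd f (g * h) = rootProd f g * rootProd f h := by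
  simp [rootProd, Multiset.prod_map_mul]

lemma rootProd_add (f g h : F[X]) :
    rootProd f (g + f * h) = rootProd f g := by
  unfold rootProd
  congr 1
  apply Multiset.map_congr rfl
  intro a ha
  have : (f.map (algebraMap F (AlgebraicClosure F))).eval a = 0 := (mem_roots'.1 ha).2
  simp only [Polynomial.map_add, Polynomial.map_mul, eval_add, eval_mul, this, zero_mul, add_zero]

lemma sign_aux (a b : ℕ) : (-1 : F) ^ ((a + b) * (a + b - 1) / 2) =
    (-1) ^ (a * (a - 1) / 2) * (-1) ^ (b * (b - 1) / 2) * (-1) ^ (a * b) := by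
  rw [← pow_add, ← pow_add]
  congr 1
  rw [← Nat.choose_two_right, ← Nat.choose_two_right, ← Nat.choose_two_right,
    Nat.add_choose_eq]
  simp [Finset.Nat.antidiagonal_succ]
  ring

lemma dd_mul (f g : F[X]) (hf : f.Monic) (hg : g.Monic) :
    dd (f * g) = dd f * dd g * resultant f g ^ 2 := by
  apply (algebraMap F (AlgebraicClosure F)).injective
  have h1 := res_eq f g hf _ le_rfl
  have h2 := res_eq g f hg _ le_rfl
  rw [resultant_comm, map_mul, h1] at h2
  rw [map_mul, map_mul, map_pow, h1, dd_eq _ (hf.mul hg), dd_eq _ hf, dd_eq _ hg,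
    rootProd_mul_left _ _ _ hf hg, derivative_mul]
  rw [rootProd_add f, show derivative f * g + f * derivative g =
    derivative g * f + g * derivative f by ring, rootProd_add g, rootProd_mul_right,
    rootProd_mul_right, ← h2, hf.natDegree_mul hg, sign_aux]
  simp only [map_pow, map_neg, map_one]
  have h3 : ((-1 : AlgebraicClosure F) ^ (f.natDegree * g.natDegree)) *
    ((-1 : AlgebraicClosure F) ^ (g.natDegree * f.natDegree)) = 1 := by
    rw [mul_comm g.natDegree, ← mul_pow]; simp
  linear_combination ((-1) ^ (f.natDegree * (f.natDegree - 1) / 2) *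
    (-1) ^ (g.natDegree * (g.natDegree - 1) / 2) * rootProd f (derivative f) *
    rootProd g (derivative g) * rootProd f g ^ 2) * h3

lemma dd_sq (f : F[X]) (hf : f.Monic) (h : ¬ Squarefree f) : dd f = 0 := by
  apply (algebraMap F (AlgebraicClosure F)).injective
  rw [dd_eq f hf, map_zero]
  simp only [Squarefree, not_forall] at h
  obtain ⟨g, ⟨k, rfl⟩, hg⟩ := h
  have hg0 : g ≠ 0 := by rintro rfl; simp at hf
  have hk0 : k ≠ 0 := by rintro rfl; simp at hf
  obtain ⟨a, ha⟩ := IsAlgClosed.exists_root (g.map (algebraMap F (AlgebraicClosure F)))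
    (by rw [degree_map]; intro h; exact hg (isUnit_iff_degree_eq_zero.2 h))
  rw [IsRoot] at ha
  apply mul_eq_zero_of_right
  apply Multiset.prod_eq_zero
  rw [Multiset.mem_map]
  refine ⟨a, ?_, ?_⟩
  · rw [mem_roots (hf.map _).ne_zero]
    simp only [IsRoot, Polynomial.map_mul, eval_mul, ha, zero_mul]
  · simp only [derivative_mul, Polynomial.map_mul, Polynomial.map_add, eval_add, eval_mul, ha]
    ring
end

section
variable {F : Type*} [Field F] [Fintype F]

lemma dd_irred_discr {L : Type*} [Field L] [Algebra F L] [FiniteDimensional F L]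
    (pb : PowerBasis F L) :
    dd (minpoly F pb.gen) = Algebra.discr F pb.basis := by
  apply (algebraMap F (AlgebraicClosure F)).injective
  have hp : (minpoly F pb.gen).Monic := minpoly.monic pb.isIntegral_gen
  rw [Algebra.discr_powerBasis_eq_norm, dd_eq _ hp, map_mul,
    Algebra.norm_eq_prod_embeddings F (AlgebraicClosure F), pb.finrank, ← pb.natDegree_minpoly]
  simp only [map_pow, map_neg, map_one]
  congr 1
  have hnodup : ((minpoly F pb.gen).aroots (AlgebraicClosure F)).Nodup :=
    nodup_roots (Separable.map (Algebra.IsSeparable.isSeparable F pb.gen))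
  symm
  rw [Fintype.prod_equiv pb.liftEquiv' _
    (fun a => eval a.1 ((derivative (minpoly F pb.gen)).map
      (algebraMap F (AlgebraicClosure F)))), Finset.prod_mem_multiset,
    Finset.prod_eq_multiset_prod, Multiset.toFinset_val, Multiset.dedup_eq_self.mpr hnodup]
  · rfl
  · intro x; rfl
  · intro σ
    rw [PowerBasis.liftEquiv'_apply_coe, ← aeval_algHom_apply, ← eval_map_algebraMap]

lemma det_frob {L : Type*} [Field L] [Algebra F L] [FiniteDimensional F L]
    (pb : PowerBasis F L) :
    ∃ δ : AlgebraicClosure F,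
      algebraMap F (AlgebraicClosure F) (dd (minpoly F pb.gen)) = δ ^ 2 ∧ δ ≠ 0 ∧
      δ ^ (Fintype.card F) = (-1) ^ ((minpoly F pb.gen).natDegree - 1) * δ := by
  have : Finite L := Module.finite_of_finite F (M := L)
  let ι : L →ₐ[F] AlgebraicClosure F := IsAlgClosed.lift
  have hd : finrank F L = pb.dim := pb.finrank
  let g : Fin pb.dim → (L →ₐ[F] AlgebraicClosure F) :=
    fun i => ι.comp (FiniteField.frobeniusAlgHom F L ^ i.1)
  have hb := FiniteField.bijective_frobeniusAlgHom_pow F L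
  rw [hd] at hb
  have hg : Function.Bijective g := by
    rw [Fintype.bijective_iff_injective_and_card]
    constructor
    · intro i j hij
      apply hb.1
      ext x
      exact ι.injective (DFunLike.congr_fun hij x)
    · rw [AlgHom.card, hd, Fintype.card_fin]
  let e := Equiv.ofBijective g hg
  have hne := Algebra.discr_not_zero_of_basis F pb.basis
  have hsq := Algebra.discr_eq_det_embeddingsMatrixReindex_pow_two F (AlgebraicClosure F) pb.basis e
  rw [dd_irred_discr]
  refine ⟨_, hsq, ?_, ?_⟩
  · intro h
    rw [h] at hsq
    apply hne
    apply (algebraMap F (AlgebraicClosure F)).injective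
    rw [hsq]; simp
  · set M := Algebra.embeddingsMatrixReindex F (AlgebraicClosure F) pb.basis e with hM
    have h1 : M.det ^ (Fintype.card F) =
      FiniteField.frobeniusAlgHom F (AlgebraicClosure F) M.det := rfl
    have h2 : (FiniteField.frobeniusAlgHom F (AlgebraicClosure F)).mapMatrix M =
      M.submatrix id (finRotate pb.dim) := by
      ext i j
      have hMe : ∀ i j, M i j = ι ((FiniteField.frobeniusAlgHom F L ^ j.1) (pb.basis i)) :=
        fun i j => rfl
      rw [AlgHom.mapMatrix_apply, Matrix.map_apply, Matrix.submatrix_apply, hMe, hMe,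
        FiniteField.coe_frobeniusAlgHom]
      show ι _ ^ _ = _
      rw [← map_pow]
      congr 1
      have h3 : ∀ x : L, x ^ Fintype.card F = FiniteField.frobeniusAlgHom F L x := fun x => rfl
      rw [h3, ← AlgHom.mul_apply, ← pow_succ']
      congr 1
      obtain ⟨n, hn⟩ : ∃ n, pb.dim = n + 1 := ⟨pb.dim - 1, by have := pb.dim_pos; omega⟩
      have ho := FiniteField.orderOf_frobeniusAlgHom F L
      rw [hd] at ho
      have : NeZero pb.dim := ⟨by omega⟩
      rw [finRotate_apply, Fin.val_add, ← pow_mod_orderOf _ (j.1 + 1), ho]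
      simp
    rw [h1, AlgHom.map_det, h2, Matrix.det_permute', sign_finRotate, pb.natDegree_minpoly]
    simp

lemma chi_irred (hodd : Odd (Fintype.card F)) (p : F[X]) (hp : p.Monic) (hi : Irreducible p) :
    quadraticChar F (dd p) = (-1) ^ (p.natDegree - 1) := by
  have : Fact (Irreducible p) := ⟨hi⟩
  have hmin : minpoly F (AdjoinRoot.powerBasis hp.ne_zero).gen = p := by
    rw [AdjoinRoot.powerBasis_gen, AdjoinRoot.minpoly_root hp.ne_zero]; simp [hp.leadingCoeff]
  have : FiniteDimensional F (AdjoinRoot p) := (AdjoinRoot.powerBasis hp.ne_zero).finite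
  obtain ⟨δ, h1, h2, h3⟩ := det_frob (AdjoinRoot.powerBasis hp.ne_zero)
  rw [hmin] at h1 h3
  have hchar : ringChar F ≠ 2 := by
    intro h
    have := FiniteField.even_card_of_char_two h
    rw [Nat.odd_iff] at hodd
    omega
  have h4 : ((quadraticChar F (dd p) : ℤ) : F) = (-1) ^ (p.natDegree - 1) := by
    rw [quadraticChar_eq_pow_of_char_ne_two' hchar]
    apply (algebraMap F (AlgebraicClosure F)).injective
    rw [map_pow, h1, ← pow_mul]
    simp only [map_pow, map_neg, map_one]
    apply mul_right_cancel₀ h2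
    rw [← h3, ← pow_succ, Nat.two_mul_div_two_add_one_of_odd hodd]
  have h5 : dd p ≠ 0 := by
    intro h
    rw [h, map_zero] at h1
    exact h2 (pow_eq_zero_iff (two_ne_zero) |>.1 h1.symm)
  have h6 : (1 : F) ≠ -1 := Ring.neg_one_ne_one_of_char_ne_two hchar |>.symm
  rcases quadraticChar_dichotomy h5 with h | h <;>
    rcases Nat.even_or_odd (p.natDegree - 1) with h' | h' <;>
    rw [h] at h4 ⊢ <;> rw [h'.neg_one_pow] at h4 ⊢ <;> exfalso <;> push_cast at h4
  · exact h6 h4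
  · exact h6 h4.symm
end

section
variable {F : Type*} [Field F] [Fintype F]

noncomputable def cc (f : F[X]) : ℤ := (-1) ^ f.natDegree * quadraticChar F (dd f)

lemma cc_mul (hodd : Odd (Fintype.card F)) (p d : F[X]) (hp : p.Monic) (hi : Irreducible p)
    (hd : d.Monic) (h : ¬ p ∣ d) : cc (p * d) = - cc d := by
  have hr : resultant p d ≠ 0 := by
    intro h0
    rw [resultant_eq_zero_iff] at h0
    exact h0.2 ((hi.coprime_iff_not_dvd).2 h)
  unfold cc
  rw [dd_mul p d hp hd, map_mul, map_mul, quadraticChar_sq_one' hr, chi_irred hodd p hp hi,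
    hp.natDegree_mul hd]
  obtain ⟨n, hn⟩ : ∃ n, p.natDegree = n + 1 := ⟨p.natDegree - 1, by
    have := hi.natDegree_pos; omega⟩
  have h3 : ((-1 : ℤ) ^ n) * (-1) ^ n = 1 := by rw [← mul_pow]; simp
  rw [hn, Nat.add_sub_cancel, pow_add, pow_succ]
  linear_combination (- (-1) ^ d.natDegree * quadraticChar F (dd d)) * h3

lemma cc_sq (f : F[X]) (hf : f.Monic) (h : ¬ Squarefree f) : cc f = 0 := by
  simp [cc, dd_sq f hf h]

variable (F) in
lemma card_monic (n : ℕ) :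
    Nat.card {p : F[X] // p.Monic ∧ p.natDegree = n} = Fintype.card F ^ n := by
  rw [Nat.card_congr ((monicEquivDegreeLT n).trans (degreeLTEquiv F n).toEquiv)]
  simp

variable (F) in
lemma fin_monic (n : ℕ) : {p : F[X] | p.Monic ∧ p.natDegree = n}.Finite := by
  have : Finite {p : F[X] // p.Monic ∧ p.natDegree = n} :=
    Nat.finite_of_card_ne_zero (by rw [card_monic]; positivity)
  exact Set.finite_coe_iff.1 this

variable (F) in
noncomputable def TT (n : ℕ) : Finset F[X] := (fin_monic F n).toFinset

lemma mem_TT (n : ℕ) (f : F[X]) : f ∈ TT F n ↔ f.Monic ∧ f.natDegree = n := by simp [TT]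

lemma card_TT (n : ℕ) : (TT F n).card = Fintype.card F ^ n := by
  rw [← card_monic, TT, ← Set.ncard_eq_toFinset_card _ (fin_monic F n)]; rfl

variable (F) in
noncomputable def PP (n : ℕ) : Finset (F[X] × F[X]) :=
  (Finset.HasAntidiagonal.antidiagonal n).biUnion (fun j => TT F j.1 ×ˢ TT F j.2)

lemma mem_PP (n : ℕ) (x : F[X] × F[X]) :
    x ∈ PP F n ↔ x.1.Monic ∧ x.2.Monic ∧ x.1.natDegree + x.2.natDegree = n := by
  simp only [PP, Finset.mem_biUnion, Finset.HasAntidiagonal.mem_antidiagonal, Finset.mem_product, mem_TT,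
    Prod.exists]
  constructor
  · rintro ⟨a, b, h, ⟨h1, rfl⟩, h2, rfl⟩
    exact ⟨h1, h2, h⟩
  · rintro ⟨h1, h2, h⟩
    exact ⟨_, _, h, ⟨h1, rfl⟩, h2, rfl⟩

lemma sum_PP (n : ℕ) : ∑ x ∈ PP F n, cc x.1 =
    ∑ j ∈ Finset.HasAntidiagonal.antidiagonal n, (∑ f ∈ TT F j.1, cc f) * (Fintype.card F : ℤ) ^ j.2 := by
  rw [PP, Finset.sum_biUnion]
  · apply Finset.sum_congr rfl
    intro j _
    rw [Finset.sum_product, Finset.sum_mul]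
    apply Finset.sum_congr rfl
    intro f _
    simp [card_TT, mul_comm]
  · intro i _ j _ hij
    rw [Function.onFun, Finset.disjoint_left]
    intro x hx hy
    simp only [Finset.mem_product, mem_TT] at hx hy
    exact hij (Prod.ext (hx.1.2.symm.trans hy.1.2) (hx.2.2.symm.trans hy.2.2))

lemma sum_PP_zero (hodd : Odd (Fintype.card F)) (n : ℕ) (hn : 1 ≤ n) :
    ∑ x ∈ PP F n, cc x.1 = 0 := by
  have hex : ∀ f : F[X], ∃ g : F[X], ¬ IsUnit f → Irreducible g ∧ g.Monic ∧ g ∣ f := by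
    intro f
    by_cases h : IsUnit f
    · exact ⟨0, fun h' => absurd h h'⟩
    · obtain ⟨g, hg⟩ := exists_monic_irreducible_factor f h
      exact ⟨g, fun _ => ⟨hg.2.1, hg.1, hg.2.2⟩⟩
  choose π hπ using hex
  have hπ' : ∀ x ∈ PP F n, Irreducible (π (x.1 * x.2)) ∧ (π (x.1 * x.2)).Monic ∧
      π (x.1 * x.2) ∣ x.1 * x.2 := by
    intro x hx
    rw [mem_PP] at hx
    apply hπ
    intro hu
    have h0 := natDegree_eq_zero_of_isUnit hu
    rw [hx.1.natDegree_mul hx.2.1] at h0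
    omega
  have hs : ∑ x ∈ PP F n, cc x.1 = ∑ x ∈ (PP F n).filter (fun x => Squarefree x.1), cc x.1 := by
    rw [Finset.sum_filter]
    apply Finset.sum_congr rfl
    intro x hx
    split_ifs with h
    · rfl
    · exact cc_sq _ ((mem_PP n x).1 hx).1 h
  rw [hs]
  let g : F[X] × F[X] → F[X] × F[X] := fun x =>
    if π (x.1 * x.2) ∣ x.1 then (x.1 /ₘ π (x.1 * x.2), π (x.1 * x.2) * x.2)
    else (π (x.1 * x.2) * x.1, x.2 /ₘ π (x.1 * x.2))
  -- summary of the behaviour of `g`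
  have key : ∀ x ∈ (PP F n).filter (fun x => Squarefree x.1),
      cc x.1 + cc (g x).1 = 0 ∧ g x ≠ x ∧ g x ∈ (PP F n).filter (fun x => Squarefree x.1) ∧
      g (g x) = x := by
    rintro ⟨d, e⟩ hx
    rw [Finset.mem_filter] at hx
    obtain ⟨hx, hsq⟩ := hx
    obtain ⟨hi, hm, hdvd⟩ := hπ' _ hx
    rw [mem_PP] at hx
    simp only at hx hsq hi hm hdvd
    obtain ⟨hd, he, hde⟩ := hx
    generalize hp : π (d * e) = p at hi hm hdvd
    have hnd := hi.natDegree_pos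
    by_cases h : p ∣ d
    · obtain ⟨k, rfl⟩ := h
      have hk : k.Monic := hm.of_mul_monic_left hd
      have hpk : ¬ p ∣ k := by
        rintro ⟨l, rfl⟩
        exact hi.not_isUnit (hsq p ⟨l, by ring⟩)
      have hg : g (p * k, e) = (k, p * e) := by
        simp only [g, hp, dvd_mul_right, if_true]
        rw [mul_divByMonic_cancel_left _ hm]
      have hg2 : g (k, p * e) = (p * k, e) := by
        have : k * (p * e) = p * k * e := by ring
        simp only [g, this, hp, if_neg hpk]
        rw [mul_divByMonic_cancel_left _ hm]
      rw [hg, hg2]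
      rw [hm.natDegree_mul hk] at hde
      refine ⟨?_, ?_, ?_, rfl⟩
      · simp [cc_mul hodd p k hm hi hk hpk]
      · intro h
        have := congrArg natDegree (Prod.ext_iff.1 h).1
        simp only [hm.natDegree_mul hk] at this
        omega
      · rw [Finset.mem_filter, mem_PP]
        refine ⟨⟨hk, hm.mul he, ?_⟩, hsq.squarefree_of_dvd (dvd_mul_left _ _)⟩
        simp only [hm.natDegree_mul he]
        omega
    · obtain ⟨k, rfl⟩ := (hi.prime.dvd_or_dvd hdvd).resolve_left h
      have hk : k.Monic := hm.of_mul_monic_left he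
      have hg : g (d, p * k) = (p * d, k) := by
        simp only [g, hp, if_neg h]
        rw [mul_divByMonic_cancel_left _ hm]
      have hg2 : g (p * d, k) = (d, p * k) := by
        have : p * d * k = d * (p * k) := by ring
        simp only [g, this, hp, dvd_mul_right, if_true]
        rw [mul_divByMonic_cancel_left _ hm]
      rw [hg, hg2]
      rw [hm.natDegree_mul hk] at hde
      refine ⟨?_, ?_, ?_, rfl⟩
      · simp [cc_mul hodd p d hm hi hd h]
      · intro h
        have := congrArg natDegree (Prod.ext_iff.1 h).1
        simp only [hm.natDegree_mul hd] at this
        omega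
      · rw [Finset.mem_filter, mem_PP]
        refine ⟨⟨hm.mul hd, hk, ?_⟩, ?_⟩
        · simp only [hm.natDegree_mul hd]
          omega
        · exact squarefree_mul_iff.2
            ⟨((hi.coprime_iff_not_dvd).2 h).isRelPrime, hi.squarefree, hsq⟩
  exact Finset.sum_involution (fun x _ => g x) (fun x hx => (key x hx).1)
    (fun x hx _ => (key x hx).2.1) (fun x hx => (key x hx).2.2.1) (fun x hx => (key x hx).2.2.2)

lemma sum_TT_zero (hodd : Odd (Fintype.card F)) (n : ℕ) (hn : 2 ≤ n) :
    ∑ f ∈ TT F n, cc f = 0 := by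
  obtain ⟨k, rfl⟩ : ∃ k, n = k + 1 := ⟨n - 1, by omega⟩
  have h1 := sum_PP_zero hodd (k + 1) (by omega)
  have h2 := sum_PP_zero hodd k (by omega)
  rw [sum_PP] at h1 h2
  rw [Finset.Nat.sum_antidiagonal_succ'] at h1
  simp only [pow_zero, mul_one, pow_succ, ← mul_assoc] at h1
  rw [← Finset.sum_mul, h2] at h1
  simpa using h1

lemma sum_chi_zero (hodd : Odd (Fintype.card F)) (n : ℕ) (hn : 2 ≤ n) :
    ∑ f ∈ TT F n, quadraticChar F (dd f) = 0 := by
  have h := sum_TT_zero (F := F) hodd n hn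
  have h' : ∑ f ∈ TT F n, cc f = (-1) ^ n * ∑ f ∈ TT F n, quadraticChar F (dd f) := by
    rw [Finset.mul_sum]
    apply Finset.sum_congr rfl
    intro f hf
    rw [cc, ((mem_TT n f).1 hf).2]
  rw [h'] at h
  simpa using h
end

/-- For any odd prime power `q` and any `m ≥ 2`, the number of monic polynomials of degree
`m` in `F_q[x]` whose discriminant is a nonzero square in `F_q` equals the number whose
discriminant is a nonsquare in `F_q`. -/
theorem stmt7 {F : Type*} [Field F] [Fintype F] (m : ℕ) (hodd : Odd (Fintype.card F))
    (hm : 2 ≤ m) :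
    {f : F[X] | f.Monic ∧ f.natDegree = m ∧
        ∃ d : F, d ≠ 0 ∧ IsSquare d ∧ polyDisc f = algebraMap F (AlgebraicClosure F) d}.ncard =
    {f : F[X] | f.Monic ∧ f.natDegree = m ∧
        ∃ d : F, ¬ IsSquare d ∧ polyDisc f = algebraMap F (AlgebraicClosure F) d}.ncard := by
  have hA : {f : F[X] | f.Monic ∧ f.natDegree = m ∧
        ∃ d : F, d ≠ 0 ∧ IsSquare d ∧ polyDisc f = algebraMap F (AlgebraicClosure F) d} =
      ((TT F m).filter (fun f => quadraticChar F (dd f) = 1) : Finset F[X]) := by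
    ext f
    simp only [Set.mem_ofPred_eq, Finset.coe_filter, mem_TT, and_assoc]
    refine and_congr_right fun hf => and_congr_right fun hd => ?_
    rw [polyDisc_eq f hf (by omega)]
    constructor
    · rintro ⟨d, h0, hs, h⟩
      rw [(algebraMap F (AlgebraicClosure F)).injective h]
      exact (quadraticChar_one_iff_isSquare h0).2 hs
    · intro h
      have h0 : dd f ≠ 0 := by intro h'; simp [h'] at h
      exact ⟨dd f, h0, (quadraticChar_one_iff_isSquare h0).1 h, rfl⟩
  have hB : {f : F[X] | f.Monic ∧ f.natDegree = m ∧
        ∃ d : F, ¬ IsSquare d ∧ polyDisc f = algebraMap F (AlgebraicClosure F) d} =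
      ((TT F m).filter (fun f => quadraticChar F (dd f) = -1) : Finset F[X]) := by
    ext f
    simp only [Set.mem_ofPred_eq, Finset.coe_filter, mem_TT, and_assoc]
    refine and_congr_right fun hf => and_congr_right fun hd => ?_
    rw [polyDisc_eq f hf (by omega)]
    constructor
    · rintro ⟨d, hs, h⟩
      rw [(algebraMap F (AlgebraicClosure F)).injective h]
      exact quadraticChar_neg_one_iff_not_isSquare.2 hs
    · intro h
      exact ⟨dd f, quadraticChar_neg_one_iff_not_isSquare.1 h, rfl⟩
  rw [hA, hB, Set.ncard_coe_finset, Set.ncard_coe_finset]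
  have h := sum_chi_zero (F := F) hodd m hm
  have h2 : ∀ f ∈ TT F m, quadraticChar F (dd f) =
      (if quadraticChar F (dd f) = 1 then 1 else 0) -
      (if quadraticChar F (dd f) = -1 then 1 else 0) := by
    intro f _
    by_cases h0 : dd f = 0
    · simp [h0]
    · rcases quadraticChar_dichotomy h0 with h | h <;> rw [h] <;> norm_num
  rw [Finset.sum_congr rfl h2, Finset.sum_sub_distrib, Finset.sum_boole, Finset.sum_boole] at h
  exact_mod_cast sub_eq_zero.1 h
end

section
/- Let q be a prime power, m ≥ 2 an integer, g = gcd(q-1, m(m-1)), and λ a partition of m such that S_{λ,F_q} is nonempty. If δ_1, δ_2 ∈ D_{λ,F_q} and δ_2/δ_1 is a g-th power in F_q^×, then the number of polynomials in S_{λ,F_q} with discriminant δ_1 equals the number of polynomials in S_{λ,F_q} with discriminant δ_2. -/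
open Polynomial
open scoped Classical

open Polynomial

/-- Scaling roots by a nonzero element, as a multiplicative automorphism of `F[X]`. -/
noncomputable def scaleEquiv {F : Type*} [Field F] (b : F) (hb : b ≠ 0) : F[X] ≃* F[X] where
  toFun f := f.scaleRoots b
  invFun f := f.scaleRoots b⁻¹
  left_inv f := by
    change (f.scaleRoots b).scaleRoots b⁻¹ = f
    rw [← scaleRoots_mul, mul_inv_cancel₀ hb, scaleRoots_one]
  right_inv f := by
    change (f.scaleRoots b⁻¹).scaleRoots b = f
    rw [← scaleRoots_mul, inv_mul_cancel₀ hb, scaleRoots_one]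
  map_mul' f g := mul_scaleRoots_of_noZeroDivisors f g b

lemma scaleEquiv_apply {F : Type*} [Field F] (b : F) (hb : b ≠ 0) (f : F[X]) :
    scaleEquiv b hb f = f.scaleRoots b := rfl

lemma hasFactorizationType_scale {F : Type*} [Field F] {f : F[X]} {m : ℕ} {lam : m.Partition}
    (h : hasFactorizationType f lam) (b : F) (hb : b ≠ 0) :
    hasFactorizationType (f.scaleRoots b) lam := by
  obtain ⟨s, hs, hprod, hdeg⟩ := h
  refine ⟨s.map (scaleEquiv b hb).toEquiv.toEmbedding, ?_, ?_, ?_⟩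
  · intro π hπ
    rw [Finset.mem_map] at hπ
    obtain ⟨ρ, hρ, rfl⟩ := hπ
    refine ⟨(monic_scaleRoots_iff b).2 (hs ρ hρ).1, ?_⟩
    exact (MulEquiv.irreducible_iff (scaleEquiv b hb)).2 (hs ρ hρ).2
  · rw [Finset.prod_map, ← hprod, ← scaleEquiv_apply b hb, map_prod]
    rfl
  · rw [Finset.map_val, Multiset.map_map, ← hdeg]
    refine Multiset.map_congr rfl fun x _ => ?_
    exact natDegree_scaleRoots x b

lemma hasFactorizationType_monic {F : Type*} [Field F] {f : F[X]} {m : ℕ} {lam : m.Partition}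
    (h : hasFactorizationType f lam) : f.Monic ∧ f.natDegree = m := by
  obtain ⟨s, hs, rfl, hdeg⟩ := h
  refine ⟨monic_prod_of_monic _ _ fun i hi => (hs i hi).1, ?_⟩
  rw [natDegree_prod_of_monic _ _ fun i hi => (hs i hi).1, ← lam.parts_sum, ← hdeg]
  rfl

lemma eval_derivative_scaleRoots {K : Type*} [Field K] (f : K[X]) (b a : K) (hb : b ≠ 0)
    (hf : 1 ≤ f.natDegree) :
    (derivative (f.scaleRoots b)).eval (b * a) =
      b ^ (f.natDegree - 1) * (derivative f).eval a := by
  have h1 : (f.scaleRoots b).comp (C b * X) = C (b ^ f.natDegree) * f := by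
    ext n
    rw [comp_C_mul_X_coeff, coeff_scaleRoots, coeff_C_mul]
    by_cases hn : n ≤ f.natDegree
    · rw [mul_assoc, ← pow_add, Nat.sub_add_cancel hn, mul_comm]
    · rw [coeff_eq_zero_of_natDegree_lt (not_le.1 hn)]
      simp
  have h2 := congrArg (fun p => (derivative p).eval a) h1
  simp only [derivative_comp, derivative_C_mul, derivative_X, eval_mul, eval_comp, eval_C,
    eval_X, mul_one] at h2
  apply mul_left_cancel₀ hb
  rw [h2, ← mul_assoc, ← pow_succ', Nat.sub_add_cancel hf]

lemma polyDisc_scaleRoots {F : Type*} [Field F] (f : F[X]) (b : F) (hb : b ≠ 0)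
    (hm : 2 ≤ f.natDegree) :
    polyDisc (f.scaleRoots b) =
      algebraMap F (AlgebraicClosure F) (b ^ (f.natDegree * (f.natDegree - 1))) *
        polyDisc f := by
  have hf0 : f ≠ 0 := by rintro rfl; simp at hm
  set φ := algebraMap F (AlgebraicClosure F) with hφ
  have hb' : φ b ≠ 0 := by simpa using hb
  have hcard : Multiset.card (f.map φ).roots = f.natDegree := by
    rw [← (IsAlgClosed.splits (f.map φ)).natDegree_eq_card_roots, natDegree_map]
  unfold polyDisc
  rw [natDegree_scaleRoots, leadingCoeff_scaleRoots, if_neg (by omega), if_neg (by omega),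
    ← hφ, ← derivative_map, ← derivative_map,
    map_scaleRoots _ _ _ (by simpa using hf0), roots_scaleRoots _ hb'.isUnit,
    Multiset.map_map]
  have : ∀ a, ((fun a => eval a (derivative ((f.map φ).scaleRoots (φ b)))) ∘ (φ b * ·)) a =
      φ b ^ (f.natDegree - 1) * eval a (derivative (f.map φ)) := by
    intro a
    have := eval_derivative_scaleRoots (f.map φ) (φ b) a hb' (by rw [natDegree_map]; omega)
    rw [natDegree_map] at this
    exact this
  rw [Multiset.map_congr rfl fun a _ => this a, Multiset.prod_map_mul, Multiset.map_const',
    Multiset.prod_replicate, hcard, ← pow_mul, map_pow, mul_comm (f.natDegree - 1)]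
  ring

/-- Let `g = gcd(q-1, m(m-1))` and let `λ` be a partition of `m ≥ 2` with `S_{λ,F_q}`
nonempty.  If `δ₁, δ₂ ∈ D_{λ,F_q}` and `δ₂/δ₁` is a `g`-th power in `F_q^×`, then the number
of polynomials in `S_{λ,F_q}` with discriminant `δ₁` equals the number with discriminant
`δ₂`. -/
theorem stmt11 {F : Type*} [Field F] [Fintype F] (q m : ℕ) (hq : Fintype.card F = q)
    (hm : 2 ≤ m) (lam : m.Partition) (δ₁ δ₂ : F)
    (hδ₁ : ∃ f : F[X], hasFactorizationType f lam ∧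
      polyDisc f = algebraMap F (AlgebraicClosure F) δ₁)
    (hδ₂ : ∃ f : F[X], hasFactorizationType f lam ∧
      polyDisc f = algebraMap F (AlgebraicClosure F) δ₂)
    (hpow : ∃ c : F, c ≠ 0 ∧ δ₂ / δ₁ = c ^ Nat.gcd (q - 1) (m * (m - 1))) :
    {f : F[X] | hasFactorizationType f lam ∧
        polyDisc f = algebraMap F (AlgebraicClosure F) δ₁}.ncard =
    {f : F[X] | hasFactorizationType f lam ∧
        polyDisc f = algebraMap F (AlgebraicClosure F) δ₂}.ncard := by
  obtain ⟨c, hc, hc2⟩ := hpow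
  have hδ : δ₁ ≠ 0 := by
    rintro rfl
    rw [div_zero] at hc2
    exact pow_ne_zero _ hc hc2.symm
  obtain ⟨b, hb, hbc⟩ : ∃ b : F, b ≠ 0 ∧
      b ^ (m * (m - 1)) = c ^ Nat.gcd (q - 1) (m * (m - 1)) := by
    refine ⟨c ^ (Nat.gcdB (q - 1) (m * (m - 1))), zpow_ne_zero _ hc, ?_⟩
    have h1 : c ^ (q - 1) = 1 := hq ▸ FiniteField.pow_card_sub_one_eq_one c hc
    rw [← zpow_natCast c, Nat.gcd_eq_gcd_ab, zpow_add₀ hc, zpow_mul, zpow_natCast, h1, one_zpow,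
      one_mul, ← zpow_natCast, ← zpow_mul, mul_comm]
  have hδ2 : δ₂ = b ^ (m * (m - 1)) * δ₁ := by
    rw [hbc, ← hc2, div_mul_cancel₀ _ hδ]
  rw [← Set.ncard_image_of_injective _ (scaleEquiv b hb).injective]
  congr 1
  ext f
  constructor
  · rintro ⟨g, ⟨hg, hd⟩, rfl⟩
    refine ⟨hasFactorizationType_scale hg b hb, ?_⟩
    have hdeg := (hasFactorizationType_monic hg).2
    rw [scaleEquiv_apply, polyDisc_scaleRoots g b hb (by omega), hd, hdeg, hδ2, map_mul]
  · rintro ⟨hf, hd⟩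
    have hb2 : b ^ (m * (m - 1)) ≠ 0 := pow_ne_zero _ hb
    have hdeg := (hasFactorizationType_monic hf).2
    refine ⟨f.scaleRoots b⁻¹, ⟨hasFactorizationType_scale hf b⁻¹ (inv_ne_zero hb), ?_⟩,
      (scaleEquiv b hb).apply_symm_apply f⟩
    rw [polyDisc_scaleRoots f b⁻¹ (inv_ne_zero hb) (by omega), hd, hdeg, hδ2, ← map_mul,
      inv_pow, inv_mul_cancel_left₀ hb2]
end

section
/- Let q be an odd prime power such that q - 1 is squarefree, and let m ≥ 2 be an integer. If for every partition λ of m (with ℓ(λ) parts) the discriminants of the polynomials in S_{λ,F_q} are equally distributed among the elements of {c ∈ F_q^× : χ_q(c) = (-1)^(m-ℓ(λ))}, then gcd(q-1, m(m-1)) = 2. -/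
open Polynomial
open scoped Classical

lemma aux_divisors (p k j : ℕ) (hp : p.Prime) (hk : 0 < k) (hkp : k < p) :
    (k * p ^ (j+1)).divisors = (k * p ^ j).divisors ∪ k.divisors.image (· * p ^ (j+1)) := by
  have hp0 : 0 < p := hp.pos
  ext d
  simp only [Nat.mem_divisors, Finset.mem_union, Finset.mem_image]
  constructor
  · rintro ⟨hd, -⟩
    obtain ⟨a, b, ha, hb, rfl⟩ := (Nat.dvd_mul).1 hd
    obtain ⟨i, hi, rfl⟩ := (Nat.dvd_prime_pow hp).1 hb
    rcases Nat.lt_or_ge i (j+1) with h | h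
    · left
      refine ⟨Nat.mul_dvd_mul ha (pow_dvd_pow _ (by omega)), by positivity⟩
    · right
      have : i = j+1 := by omega
      subst this
      exact ⟨a, ⟨ha, hk.ne'⟩, rfl⟩
  · rintro (⟨h, -⟩ | ⟨a, ⟨ha, -⟩, rfl⟩)
    · exact ⟨h.trans (Nat.mul_dvd_mul_left _ (pow_dvd_pow _ (by omega))), by positivity⟩
    · exact ⟨Nat.mul_dvd_mul_right ha _, by positivity⟩

lemma aux_disj (p k j : ℕ) (hp : p.Prime) (hk : 0 < k) (hkp : k < p) :
    Disjoint (k * p ^ j).divisors (k.divisors.image (· * p ^ (j+1))) := by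
  rw [Finset.disjoint_left]
  intro d hd hd'
  simp only [Nat.mem_divisors, Finset.mem_image] at hd hd'
  obtain ⟨a, ⟨ha, -⟩, rfl⟩ := hd'
  have h1 : p ^ (j+1) ∣ k * p ^ j := (Dvd.intro_left _ rfl).trans hd.1
  rw [pow_succ', Nat.mul_dvd_mul_iff_right (pow_pos hp.pos _)] at h1
  exact absurd (Nat.le_of_dvd hk h1) (by omega)

lemma aux_B (p q j : ℕ) (hp : p.Prime) (hp2 : p ≠ 2) (hq : 2 ≤ q) (h1 : p ∣ q - 1)
    (h2 : ¬ p ^ 2 ∣ q - 1) :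
    ∃ B : ℤ, (p:ℤ) ^ (j+1) * B = (q:ℤ) ^ (p ^ (j+1)) - (q:ℤ) ^ (p ^ j) ∧ ¬ (p:ℤ) ∣ B := by
  have hpodd : Odd p := hp.odd_of_ne_two hp2
  have hdv : (p:ℤ) ∣ (q:ℤ) - 1 := by
    have := Int.natCast_dvd_natCast.2 h1
    rwa [Nat.cast_sub (by omega), Nat.cast_one] at this
  have hpi : Prime (p:ℤ) := Nat.prime_iff_prime_int.1 hp
  have hndq : ¬ (p:ℤ) ∣ (q:ℤ) := by
    intro h
    have := dvd_sub h hdv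
    simp at this
    exact hpi.not_isUnit (isUnit_of_dvd_one this)
  have e1 : emultiplicity (p:ℤ) ((q:ℤ) - 1) = 1 := by
    rw [show (1:ℕ∞) = ((1:ℕ):ℕ∞) from rfl, emultiplicity_eq_coe]
    refine ⟨by simpa using hdv, fun h => h2 ?_⟩
    rw [← Int.natCast_dvd_natCast, Nat.cast_sub (by omega)]
    simpa using h
  have e2 : emultiplicity p (p ^ j * (p - 1)) = (j:ℕ) := by
    rw [emultiplicity_eq_coe]
    refine ⟨Dvd.intro _ rfl, fun h => ?_⟩
    rw [pow_succ, Nat.mul_dvd_mul_iff_left (pow_pos hp.pos _)] at h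
    have := hp.two_le
    exact absurd (Nat.le_of_dvd (by omega) h) (by omega)
  have e3 := Int.emultiplicity_pow_sub_pow hp hpodd (x := (q:ℤ)) (y := 1) hdv hndq (p ^ j * (p-1))
  rw [e1, e2, one_pow, show (1:ℕ∞) + (j:ℕ) = ((j+1 : ℕ):ℕ∞) by push_cast; ring,
    emultiplicity_eq_coe] at e3
  obtain ⟨⟨C, hC⟩, hn⟩ := e3
  refine ⟨(q:ℤ) ^ (p^j) * C, ?_, ?_⟩
  · rw [mul_left_comm, ← hC, mul_sub, ← pow_add, mul_one]
    congr 2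
    obtain ⟨r, rfl⟩ : ∃ r, p = r + 1 := ⟨p - 1, by have := hp.two_le; omega⟩
    simp; ring
  · intro h
    rcases hpi.dvd_or_dvd h with h | h
    · exact hndq (hpi.dvd_of_dvd_pow h)
    · apply hn
      rw [hC, pow_succ _ (j+1)]
      exact mul_dvd_mul_left _ h

lemma aux_N (p q : ℕ) (N : ℕ → ℕ) (hp : p.Prime) (hp2 : p ≠ 2) (hq : 2 ≤ q) (h1 : p ∣ q - 1)
    (h2 : ¬ p ^ 2 ∣ q - 1) (hN : ∀ n, n ≠ 0 → ∑ d ∈ n.divisors, d * N d = q ^ n)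
    (k j : ℕ) (hk : 0 < k) (hkp : k < p) : ¬ p ∣ N (k * p ^ (j+1)) := by
  obtain ⟨B, hB, hpB⟩ := aux_B p q j hp hp2 hq h1 h2
  have : Fact p.Prime := ⟨hp⟩
  have hq1 : (q : ZMod p) = 1 := by
    have : ((q - 1 : ℕ) : ZMod p) = 0 := (ZMod.natCast_eq_zero_iff _ _).2 h1
    rw [Nat.cast_sub (by omega)] at this
    simpa [sub_eq_zero] using this
  have key : ∀ k, 0 < k → k < p →
      ∑ e ∈ k.divisors, (e : ZMod p) * (N (e * p ^ (j+1)) : ZMod p) = (B : ZMod p) * k := by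
    intro k hk hkp
    have hp0 := hp.pos
    have s1 := hN (k * p ^ (j+1)) (by positivity)
    have s0 := hN (k * p ^ j) (by positivity)
    rw [aux_divisors p k j hp hk hkp, Finset.sum_union (aux_disj p k j hp hk hkp), s0,
      Finset.sum_image (by
        intro a _ b _ h
        exact Nat.eq_of_mul_eq_mul_right (pow_pos hp0 _) h)] at s1
    have s2 : (∑ e ∈ k.divisors, (e : ℤ) * (N (e * p ^ (j+1)) : ℤ)) =
        B * ∑ i ∈ Finset.range k, ((q:ℤ) ^ (p^(j+1))) ^ i * ((q:ℤ) ^ (p^j)) ^ (k - 1 - i) := by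
      have hne : (p:ℤ) ^ (j+1) ≠ 0 := by positivity
      apply mul_left_cancel₀ hne
      rw [← mul_assoc, hB, mul_comm, mul_comm (_ - _), geom_sum₂_mul, ← pow_mul, ← pow_mul]
      have s1' : ((∑ e ∈ k.divisors, e * p ^ (j+1) * N (e * p ^ (j+1)) : ℕ) : ℤ) =
        (q:ℤ) ^ (k * p ^(j+1)) - (q:ℤ) ^ (k * p ^j) := by
        rw [eq_sub_iff_add_eq, add_comm]
        exact_mod_cast s1
      rw [mul_comm _ k, mul_comm _ k, ← s1', Finset.sum_mul]
      push_cast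
      exact Finset.sum_congr rfl fun _ _ => by ring
    have s3 := congrArg (Int.cast : ℤ → ZMod p) s2
    push_cast at s3
    rw [s3, hq1]
    simp
  have key2 : ∀ k, 0 < k → k < p →
      (k : ZMod p) * (N (k * p ^ (j+1)) : ZMod p) = (B : ZMod p) * (k.totient : ZMod p) := by
    intro k
    induction k using Nat.strong_induction_on with
    | _ k ih =>
      intro hk hkp
      have a1 := key k hk hkp
      have a2 : ((∑ e ∈ k.divisors, e.totient : ℕ) : ZMod p) = k := by rw [Nat.sum_totient]
      rw [← a2, ← Nat.cons_self_properDivisors hk.ne', Finset.sum_cons, Finset.sum_cons] at a1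
      push_cast at a1
      rw [mul_add, Finset.mul_sum] at a1
      have a3 : ∑ e ∈ k.properDivisors, (e : ZMod p) * (N (e * p ^ (j+1)) : ZMod p) =
          ∑ e ∈ k.properDivisors, (B : ZMod p) * (e.totient : ZMod p) := by
        refine Finset.sum_congr rfl fun e he => ?_
        rw [Nat.mem_properDivisors] at he
        exact ih e he.2 (Nat.pos_of_dvd_of_pos he.1 hk) (he.2.trans hkp)
      rw [a3] at a1
      exact add_right_cancel a1
  intro hdv
  have b := key2 k hk hkp
  rw [(ZMod.natCast_eq_zero_iff _ _).2 hdv, mul_zero] at b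
  rcases mul_eq_zero.1 b.symm with h | h
  · exact hpB ((ZMod.intCast_zmod_eq_zero_iff_dvd _ _).1 h)
  · rw [ZMod.natCast_eq_zero_iff] at h
    have := Nat.le_of_dvd (Nat.totient_pos.2 hk) h
    have := Nat.totient_le k
    omega

lemma aux_digits (p : ℕ) (hp : 2 ≤ p) (n : ℕ) : ∃ s : Finset ℕ, ∑ x ∈ s, x = n ∧
    ∀ x ∈ s, ∃ k j, 0 < k ∧ k < p ∧ x = k * p ^ j := by
  induction n using Nat.strong_induction_on with
  | _ n ih =>
    rcases Nat.eq_zero_or_pos n with rfl | hn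
    · exact ⟨∅, by simp⟩
    obtain ⟨s, hs, hs'⟩ := ih (n / p) (Nat.div_lt_self hn hp)
    have hinj : Set.InjOn (fun x => x * p) (s : Set ℕ) := fun a _ b _ h =>
      Nat.eq_of_mul_eq_mul_right (by omega) h
    have hsum : ∑ x ∈ s.image (fun x => x * p), x = n / p * p := by
      rw [Finset.sum_image hinj, ← Finset.sum_mul, hs]
    have hmem : ∀ x ∈ s.image (fun x => x * p), ∃ k j, 0 < k ∧ k < p ∧ x = k * p ^ j := by
      intro x hx
      obtain ⟨y, hy, rfl⟩ := Finset.mem_image.1 hx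
      obtain ⟨k, j, h1, h2, rfl⟩ := hs' y hy
      exact ⟨k, j+1, h1, h2, by ring⟩
    rcases Nat.eq_zero_or_pos (n % p) with h0 | h0
    · exact ⟨_, by rw [hsum]; have := Nat.div_add_mod' n p; omega, hmem⟩
    · refine ⟨insert (n % p) (s.image (fun x => x * p)), ?_, ?_⟩
      · rw [Finset.sum_insert, hsum]
        · have := Nat.div_add_mod' n p; omega
        · intro h
          obtain ⟨y, hy, hy'⟩ := Finset.mem_image.1 h
          have hlt := Nat.mod_lt n (show p > 0 by omega)
          rcases Nat.eq_zero_or_pos y with rfl | hy0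
          · simp at hy'; omega
          · nlinarith
      · intro x hx
        rcases Finset.mem_insert.1 hx with rfl | hx
        · exact ⟨n % p, 0, h0, Nat.mod_lt _ (by omega), by simp⟩
        · exact hmem x hx

lemma aux_parts (p m : ℕ) (hp : p.Prime) (h : p ∣ m * (m - 1)) (hm : 2 ≤ m) :
    ∃ s : Finset ℕ, ∑ x ∈ s, x = m ∧
    ∀ x ∈ s, x = 1 ∨ ∃ k j, 0 < k ∧ k < p ∧ x = k * p ^ (j+1) := by
  have base : ∀ n, ∃ s : Finset ℕ, ∑ x ∈ s, x = n * p ∧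
    ∀ x ∈ s, ∃ k j, 0 < k ∧ k < p ∧ x = k * p ^ (j+1) := by
    intro n
    obtain ⟨s, hs, hs'⟩ := aux_digits p hp.two_le n
    have hinj : Set.InjOn (fun x => x * p) (s : Set ℕ) := fun a _ b _ h =>
      Nat.eq_of_mul_eq_mul_right hp.pos h
    refine ⟨s.image (fun x => x * p), by rw [Finset.sum_image hinj, ← Finset.sum_mul, hs], ?_⟩
    intro x hx
    obtain ⟨y, hy, rfl⟩ := Finset.mem_image.1 hx
    obtain ⟨k, j, h1, h2, rfl⟩ := hs' y hy
    exact ⟨k, j, h1, h2, by ring⟩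
  rcases hp.dvd_mul.1 h with ⟨n, h⟩ | ⟨n, h⟩
  · obtain ⟨s, hs, hs'⟩ := base n
    exact ⟨s, by rw [hs, h, mul_comm], fun x hx => Or.inr (hs' x hx)⟩
  · obtain ⟨s, hs, hs'⟩ := base n
    refine ⟨insert 1 s, ?_, ?_⟩
    · rw [Finset.sum_insert, hs, mul_comm, ← h]
      · omega
      · intro h1
        obtain ⟨k, j, -, -, e⟩ := hs' 1 h1
        have : p ∣ 1 := by rw [e, pow_succ]; exact ⟨k * p^j, by ring⟩
        exact hp.one_lt.ne' (Nat.dvd_one.1 this)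
    · intro x hx
      rcases Finset.mem_insert.1 hx with rfl | hx
      · exact Or.inl rfl
      · exact Or.inr (hs' x hx)

noncomputable def auxIrr (F : Type*) [Field F] (n : ℕ) : Finset F[X] :=
  (UniqueFactorizationMonoid.normalizedFactors (X ^ (Nat.card F) ^ n - X : F[X])).toFinset

noncomputable def auxIrrs (F : Type*) [Field F] (n : ℕ) : Finset F[X] :=
  (auxIrr F n).filter (fun f => f.natDegree = n)

section
variable {F : Type*} [Field F] [Finite F]

lemma aux_card_gt (n : ℕ) (hn : n ≠ 0) : 1 < (Nat.card F) ^ n :=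
  Nat.one_lt_pow hn Finite.one_lt_card

lemma aux_P_ne (n : ℕ) (hn : n ≠ 0) : (X ^ (Nat.card F) ^ n - X : F[X]) ≠ 0 :=
  FiniteField.X_pow_card_pow_sub_X_ne_zero F hn Finite.one_lt_card

lemma aux_P_monic (n : ℕ) (hn : n ≠ 0) : (X ^ (Nat.card F) ^ n - X : F[X]).Monic := by
  apply monic_X_pow_sub
  rw [degree_X]
  exact_mod_cast aux_card_gt (F := F) n hn

lemma aux_P_sqf (n : ℕ) (hn : n ≠ 0) : Squarefree (X ^ (Nat.card F) ^ n - X : F[X]) := by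
  apply Separable.squarefree
  have := Fintype.ofFinite F
  obtain ⟨p, hp⟩ := CharP.exists F
  apply galois_poly_separable p
  obtain ⟨k, hpr, hc⟩ := FiniteField.card F p
  rw [Nat.card_eq_fintype_card, hc]
  exact dvd_pow (dvd_pow_self _ k.pos.ne') hn

lemma aux_mem_irr (n : ℕ) (hn : n ≠ 0) (f : F[X]) :
    f ∈ auxIrr F n ↔ f.Monic ∧ Irreducible f ∧ f.natDegree ∣ n := by
  rw [auxIrr, Multiset.mem_toFinset, UniqueFactorizationMonoid.mem_normalizedFactors_iff' (aux_P_ne n hn)]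
  constructor
  · rintro ⟨h1, h2, h3⟩
    exact ⟨by rw [← h2]; exact monic_normalize h1.ne_zero, h1,
      (h1.natDegree_dvd_iff_dvd_X_pow_card_pow_sub_X).2 h3⟩
  · rintro ⟨h1, h2, h3⟩
    exact ⟨h2, h1.normalize_eq_self, (h2.natDegree_dvd_iff_dvd_X_pow_card_pow_sub_X).1 h3⟩

lemma aux_mem_irrs (n : ℕ) (hn : n ≠ 0) (f : F[X]) :
    f ∈ auxIrrs F n ↔ f.Monic ∧ Irreducible f ∧ f.natDegree = n := by
  rw [auxIrrs, Finset.mem_filter, aux_mem_irr n hn]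
  constructor
  · tauto
  · rintro ⟨h1, h2, h3⟩
    exact ⟨⟨h1, h2, h3 ▸ dvd_rfl⟩, h3⟩

lemma aux_sum (n : ℕ) (hn : n ≠ 0) :
    ∑ d ∈ n.divisors, d * (auxIrrs F d).card = (Nat.card F) ^ n := by
  have hprod : ∏ f ∈ auxIrr F n, f = (X ^ (Nat.card F) ^ n - X : F[X]) := by
    have h := UniqueFactorizationMonoid.prod_normalizedFactors_eq (aux_P_ne (F := F) n hn)
    rw [(aux_P_monic n hn).normalize_eq_self] at h
    have hnd := (UniqueFactorizationMonoid.squarefree_iff_nodup_normalizedFactors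
      (aux_P_ne (F := F) n hn)).1 (aux_P_sqf n hn)
    conv_rhs => rw [← h]
    rw [Finset.prod, auxIrr, Multiset.toFinset_val, Multiset.dedup_eq_self.2 hnd, Multiset.map_id']
  have hdeg : ∑ f ∈ auxIrr F n, f.natDegree = (Nat.card F) ^ n := by
    rw [← natDegree_prod_of_monic _ _ (fun f hf => ((aux_mem_irr n hn f).1 hf).1), hprod]
    exact FiniteField.X_pow_card_sub_X_natDegree_eq F (aux_card_gt n hn)
  rw [← hdeg, ← Finset.sum_fiberwise_of_maps_to (t := n.divisors) (g := natDegree)]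
  · refine Finset.sum_congr rfl fun d hd => ?_
    have hd' := Nat.mem_divisors.1 hd
    have hd0 : d ≠ 0 := by rintro rfl; simp at hd
    have : (auxIrr F n).filter (fun f => f.natDegree = d) = auxIrrs F d := by
      ext f
      rw [aux_mem_irrs d hd0, Finset.mem_filter, aux_mem_irr n hn]
      constructor
      · tauto
      · rintro ⟨h1, h2, h3⟩
        exact ⟨⟨h1, h2, h3 ▸ hd'.1⟩, h3⟩
    rw [this, Finset.sum_congr rfl (fun f hf => ((aux_mem_irrs d hd0 f).1 hf).2.2)]
    simp [mul_comm]
  · intro f hf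
    exact Nat.mem_divisors.2 ⟨((aux_mem_irr n hn f).1 hf).2.2, hn⟩

lemma aux_unique (s t : Finset F[X]) (hs : ∀ f ∈ s, f.Monic ∧ Irreducible f)
    (ht : ∀ f ∈ t, f.Monic ∧ Irreducible f) (h : ∏ f ∈ s, f = ∏ f ∈ t, f) : s = t := by
  have key : ∀ s : Finset F[X], (∀ f ∈ s, f.Monic ∧ Irreducible f) → ∀ g : F[X], g ∈ s ↔
      g.Monic ∧ Irreducible g ∧ g ∣ ∏ f ∈ s, f := by
    intro s hs g
    constructor
    · intro hg
      exact ⟨(hs g hg).1, (hs g hg).2, Finset.dvd_prod_of_mem _ hg⟩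
    · rintro ⟨h1, h2, h3⟩
      obtain ⟨f, hf, hgf⟩ := (h2.prime.dvd_finsetProd_iff _).1 h3
      have := eq_of_monic_of_associated h1 (hs f hf).1 (h2.associated_of_dvd (hs f hf).2 hgf)
      rwa [this]
  ext g
  rw [key s hs, key t ht, h]

lemma aux_count (m : ℕ) (lam : m.Partition) (s : Finset ℕ) (hs : lam.parts = s.val) (h0 : 0 ∉ s) :
    {f : F[X] | hasFactorizationType f lam}.ncard = ∏ d ∈ s, (auxIrrs F d).card := by
  have hne : ∀ d ∈ s, d ≠ 0 := fun d hd h => h0 (h ▸ hd)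
  rw [← Finset.card_pi]
  set Φ : (∀ a ∈ s, F[X]) → Finset F[X] := fun g => s.attach.image (fun a => g a.1 a.2) with hΦ
  have hmemg : ∀ g ∈ s.pi (fun d => auxIrrs F d), ∀ a (ha : a ∈ s),
      (g a ha).Monic ∧ Irreducible (g a ha) ∧ (g a ha).natDegree = a := by
    intro g hg a ha
    exact (aux_mem_irrs a (hne a ha) _).1 (Finset.mem_pi.1 hg a ha)
  have hΦm : ∀ g ∈ s.pi (fun d => auxIrrs F d), ∀ f ∈ Φ g, f.Monic ∧ Irreducible f := by
    intro g hg f hf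
    obtain ⟨a, -, rfl⟩ := Finset.mem_image.1 hf
    exact ⟨(hmemg g hg a.1 a.2).1, (hmemg g hg a.1 a.2).2.1⟩
  have himg : {f : F[X] | hasFactorizationType f lam} =
      (((s.pi (fun d => auxIrrs F d)).image (fun g => ∏ f ∈ Φ g, f) : Finset F[X]) : Set F[X]) := by
    ext f
    simp only [Set.mem_ofPred_eq, Finset.coe_image, Set.mem_image, Finset.mem_coe]
    constructor
    · rintro ⟨t, ht, rfl, ht'⟩
      rw [hs] at ht'
      have hex : ∀ a ∈ s, ∃ f ∈ t, f.natDegree = a := by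
        intro a ha
        have : a ∈ Multiset.map natDegree t.val := by rw [ht']; exact ha
        obtain ⟨f, hf, h⟩ := Multiset.mem_map.1 this
        exact ⟨f, hf, h⟩
      choose g hg hg' using hex
      have hinj : Set.InjOn natDegree (t : Set F[X]) := by
        have hnd : (Multiset.map natDegree t.val).Nodup := by rw [ht']; exact s.nodup
        intro x hx y hy hxy
        exact Multiset.inj_on_of_nodup_map hnd x hx y hy hxy
      refine ⟨g, ?_, ?_⟩
      · rw [Finset.mem_pi]
        intro a ha
        rw [aux_mem_irrs a (hne a ha)]
        exact ⟨(ht _ (hg a ha)).1, (ht _ (hg a ha)).2, hg' a ha⟩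
      · congr 1
        ext f
        simp only [hΦ, Finset.mem_image, Finset.mem_attach, true_and, Subtype.exists]
        constructor
        · rintro ⟨a, ha, rfl⟩
          exact hg a ha
        · intro hf
          have hfs : f.natDegree ∈ s := by
            have : f.natDegree ∈ Multiset.map natDegree t.val := Multiset.mem_map_of_mem _ hf
            rw [ht'] at this; exact this
          exact ⟨f.natDegree, hfs, hinj (hg _ hfs) hf (hg' _ hfs)⟩
    · rintro ⟨g, hg, rfl⟩
      refine ⟨Φ g, hΦm g hg, rfl, ?_⟩
      rw [hs]
      have hinj : Set.InjOn (fun a : s => g a.1 a.2) (s.attach : Set s) := by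
        intro a _ b _ hab
        have := congrArg natDegree hab
        simp only [(hmemg g hg a.1 a.2).2.2, (hmemg g hg b.1 b.2).2.2] at this
        exact Subtype.ext this
      rw [hΦ]
      simp only
      rw [Finset.image_val_of_injOn hinj, Multiset.map_map]
      have : ∀ a ∈ s.attach.val, (natDegree ∘ fun a : s => g a.1 a.2) a = a.1 := by
        intro a _
        exact (hmemg g hg a.1 a.2).2.2
      rw [Multiset.map_congr rfl this]
      exact Multiset.attach_map_val s.val
  rw [himg, Set.ncard_coe_finset, Finset.card_image_of_injOn]
  intro g hg g' hg' h
  have e := aux_unique _ _ (hΦm g hg) (hΦm g' hg') h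
  funext a ha
  have : g a ha ∈ Φ g' := by
    rw [← e]
    exact Finset.mem_image.2 ⟨⟨a, ha⟩, Finset.mem_attach _ _, rfl⟩
  obtain ⟨b, -, hb⟩ := Finset.mem_image.1 this
  have hd := congrArg natDegree hb
  simp only [(hmemg g hg a ha).2.2, (hmemg g' hg' b.1 b.2).2.2] at hd
  obtain ⟨b, hb'⟩ := b
  subst hd
  exact hb.symm
end

lemma aux_T {F : Type*} [Field F] [Fintype F] [DecidableEq F] (hodd : Odd (Fintype.card F)) (k : ℕ) :
    2 * {c : F | c ≠ 0 ∧ quadraticChar F c = (-1 : ℤ) ^ k}.ncard = Fintype.card F - 1 := by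
  have hchar : ringChar F ≠ 2 := by
    intro h
    exact (Nat.not_even_iff_odd.2 hodd) (Nat.even_iff.2 (FiniteField.even_card_of_char_two h))
  set ε : ℤ := (-1)^k with hε
  have hε2 : ε = 1 ∨ ε = -1 := neg_one_pow_eq_or ℤ k
  set T : Finset F := Finset.univ.filter (fun c => c ≠ 0 ∧ quadraticChar F c = ε) with hT
  have e : {c : F | c ≠ 0 ∧ quadraticChar F c = ε} = (T : Set F) := by ext; simp [hT]
  rw [e, Set.ncard_coe_finset]
  have h1 : ∑ c ∈ Finset.univ.erase (0:F), (1 + ε * quadraticChar F c) = 2 * (T.card : ℤ) := by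
    have : T = (Finset.univ.erase (0:F)).filter (fun c => quadraticChar F c = ε) := by
      ext; simp [hT]
    rw [this, Finset.card_filter]
    push_cast
    rw [Finset.mul_sum]
    refine Finset.sum_congr rfl fun c hc => ?_
    have hc0 : c ≠ 0 := Finset.ne_of_mem_erase hc
    rcases quadraticChar_dichotomy hc0 with h | h <;> rcases hε2 with h' | h' <;> rw [h, h'] <;> norm_num
  have h2 : ∑ c ∈ Finset.univ.erase (0:F), quadraticChar F c = 0 := by
    rw [Finset.sum_erase _ (by simp)]
    exact quadraticChar_sum_zero hchar
  rw [Finset.sum_add_distrib, ← Finset.mul_sum, h2] at h1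
  simp only [Finset.sum_const, Finset.card_erase_of_mem (Finset.mem_univ _), Finset.card_univ] at h1
  simp at h1
  have : 0 < Fintype.card F := Fintype.card_pos
  omega

/-- Converse direction for odd `q` with `q - 1` squarefree: if for every partition `λ` of
`m ≥ 2` the discriminants of the polynomials in `S_{λ,F_q}` are equally distributed among the
elements of `T_λ = {c ∈ F_q^× : χ_q(c) = (-1)^(m-ℓ(λ))}` (i.e. each `d ∈ T_λ` is the
discriminant of exactly `|S_{λ,F_q}|/|T_λ|` polynomials of `S_{λ,F_q}`), then
`gcd(q-1, m(m-1)) = 2`. -/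
theorem stmt16 {F : Type*} [Field F] [Fintype F] [DecidableEq F] (q m : ℕ)
    (hq : Fintype.card F = q) (hodd : Odd q) (hsf : Squarefree (q - 1)) (hm : 2 ≤ m)
    (hdist : ∀ lam : m.Partition, ∀ d : F, d ≠ 0 →
      quadraticChar F d = (-1 : ℤ) ^ (m - lam.parts.card) →
      {f : F[X] | hasFactorizationType f lam ∧
          polyDisc f = algebraMap F (AlgebraicClosure F) d}.ncard *
        {c : F | c ≠ 0 ∧ quadraticChar F c = (-1 : ℤ) ^ (m - lam.parts.card)}.ncard =
      {f : F[X] | hasFactorizationType f lam}.ncard) :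
    Nat.gcd (q - 1) (m * (m - 1)) = 2 := by
  classical
  subst hq
  have hq1 : 1 < Fintype.card F := Fintype.one_lt_card
  have hcard : Nat.card F = Fintype.card F := Nat.card_eq_fintype_card
  have hg0 : Nat.gcd (Fintype.card F - 1) (m * (m - 1)) ≠ 0 :=
    (Nat.gcd_pos_of_pos_left _ (by omega)).ne'
  have h2g : 2 ∣ Nat.gcd (Fintype.card F - 1) (m * (m - 1)) := by
    apply Nat.dvd_gcd
    · obtain ⟨r, hr⟩ := hodd
      exact ⟨r, by omega⟩
    · have := Nat.even_mul_pred_self m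
      exact this.two_dvd
  by_contra hne
  obtain ⟨p, hp, hp2, hpg⟩ : ∃ p, p.Prime ∧ p ≠ 2 ∧
      p ∣ Nat.gcd (Fintype.card F - 1) (m * (m - 1)) := by
    obtain ⟨c, hc⟩ := h2g
    have hc1 : c ≠ 1 := by rintro rfl; exact hne (by omega)
    obtain ⟨p, hp, hpc⟩ := Nat.exists_prime_and_dvd hc1
    refine ⟨p, hp, ?_, hc ▸ Dvd.dvd.mul_left hpc 2⟩
    rintro rfl
    have h4 : 2 * 2 ∣ Fintype.card F - 1 :=
      (hc ▸ Nat.mul_dvd_mul_left 2 hpc).trans (Nat.gcd_dvd_left _ (m * (m - 1)))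
    have := hsf 2 h4
    simp at this
  have hpq : p ∣ Fintype.card F - 1 := hpg.trans (Nat.gcd_dvd_left _ _)
  have hpm : p ∣ m * (m - 1) := hpg.trans (Nat.gcd_dvd_right _ _)
  have hpq2 : ¬ p ^ 2 ∣ Fintype.card F - 1 := by
    intro h
    rw [pow_two] at h
    exact hp.one_lt.ne' (Nat.isUnit_iff.1 (hsf p h))
  obtain ⟨s, hs, hs'⟩ := aux_parts p m hp hpm hm
  have h0 : 0 ∉ s := by
    intro h
    rcases hs' 0 h with h | ⟨k, j, hk, -, h⟩
    · omega
    · have := hp.pos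
      have : 0 < k * p ^ (j+1) := by positivity
      omega
  let lam : m.Partition :=
    { parts := s.val
      parts_pos := fun {i} hi => Nat.pos_of_ne_zero (fun h => h0 (h ▸ hi))
      parts_sum := by rw [← hs]; exact (Finset.sum_val s) }
  have hcount := aux_count (F := F) m lam s rfl h0
  have hnd : ¬ p ∣ ∏ d ∈ s, (auxIrrs F d).card := by
    rw [hp.prime.dvd_finsetProd_iff]
    rintro ⟨d, hd, hdv⟩
    rcases hs' d hd with rfl | ⟨k, j, hk, hkp, rfl⟩
    · have h1 := aux_sum (F := F) 1 one_ne_zero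
      simp at h1
      rw [h1] at hdv
      have := (Nat.dvd_sub hdv hpq)
      rw [show Fintype.card F - (Fintype.card F - 1) = 1 by omega] at this
      exact hp.one_lt.ne' (Nat.dvd_one.1 this)
    · exact aux_N p (Fintype.card F) (fun d => (auxIrrs F d).card) hp hp2 hq1 hpq hpq2
        (fun n hn => by rw [aux_sum n hn, hcard]) k j hk hkp hdv
  have hT := aux_T (F := F) hodd (m - lam.parts.card)
  have hpT : p ∣ {c : F | c ≠ 0 ∧ quadraticChar F c = (-1 : ℤ) ^ (m - lam.parts.card)}.ncard := by
    rw [← hT] at hpq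
    rcases hp.dvd_mul.1 hpq with h | h
    · exact absurd ((Nat.prime_dvd_prime_iff_eq hp Nat.prime_two).1 h) hp2
    · exact h
  obtain ⟨d, hd0, hd⟩ : {c : F | c ≠ 0 ∧
      quadraticChar F c = (-1 : ℤ) ^ (m - lam.parts.card)}.Nonempty := by
    apply Set.nonempty_of_ncard_ne_zero
    omega
  have hfin := hdist lam d hd0 hd
  apply hnd
  rw [← hcount, ← hfin]
  exact Dvd.dvd.mul_left hpT _
end
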